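/- Let u₀ be a ground state with initial value α₀ = u₀(0), and let α > α₀. Then the solution u of the IVP with initial value α changes sign and has a finite, nonzero number of zeros z₁ < ⋯ < z_k; moreover, either u is a bound state with |u(r)| → 0 as r → ∞, or behind its last zero u oscillates about 1 or about −1, i.e. either the set { r > z_k : u(r) = 1 } or the set { r > z_k : u(r) = −1 } is infinite. -/

import Mathlib

open Real Filter Set

/-- The nonlinearity `f(s) = -s + |s|^(p-1) s`. -/
noncomputable def f (p s : ℝ) : ℝ := -s + |s| ^ (p - 1) * s

/-- The derivative of the nonlinearity, `f'(s) = -1 + p |s|^(p-1)`. -/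
noncomputable def fder (p s : ℝ) : ℝ := -1 + p * |s| ^ (p - 1)

/-- The primitive `F(s) = -s^2/2 + |s|^(p+1)/(p+1)`. -/
noncomputable def F (p s : ℝ) : ℝ := -s ^ 2 / 2 + |s| ^ (p + 1) / (p + 1)

/-- `u : [0,∞) → ℝ` (modeled on `Set.Ici 0`) is a C² solution of the IVP
`u'' + ((n-1)/r) u' + f(u) = 0`, `u(0) = α`, `u'(0) = 0`; the data `u'`, `u''`
are its first and second derivatives on `[0,∞)`. -/
structure IsSolution (n : ℕ) (p α : ℝ) (u u' u'' : ℝ → ℝ) : Prop where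
  init : u 0 = α
  initDeriv : u' 0 = 0
  hasDeriv1 : ∀ r ∈ Set.Ici (0:ℝ), HasDerivWithinAt u (u' r) (Set.Ici 0) r
  hasDeriv2 : ∀ r ∈ Set.Ici (0:ℝ), HasDerivWithinAt u' (u'' r) (Set.Ici 0) r
  cont2 : ContinuousOn u'' (Set.Ici 0)
  ode : ∀ r : ℝ, 0 < r → u'' r + ((n : ℝ) - 1) / r * u' r + f p (u r) = 0

/-- The variation `v` associated with a solution `u`: the C² solution of the linearized
equation `v'' + ((n-1)/r) v' + f'(u) v = 0`, `v(0) = 1`, `v'(0) = 0`. -/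
structure IsVariation (n : ℕ) (p : ℝ) (u v v' v'' : ℝ → ℝ) : Prop where
  init : v 0 = 1
  initDeriv : v' 0 = 0
  hasDeriv1 : ∀ r ∈ Set.Ici (0:ℝ), HasDerivWithinAt v (v' r) (Set.Ici 0) r
  hasDeriv2 : ∀ r ∈ Set.Ici (0:ℝ), HasDerivWithinAt v' (v'' r) (Set.Ici 0) r
  cont2 : ContinuousOn v'' (Set.Ici 0)
  ode : ∀ r : ℝ, 0 < r → v'' r + ((n : ℝ) - 1) / r * v' r + fder p (u r) * v r = 0

/-- `u` is decaying: `u(r) → 0` and `u'(r) → 0` as `r → ∞`. -/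
def Decaying (u u' : ℝ → ℝ) : Prop :=
  Filter.Tendsto u Filter.atTop (nhds 0) ∧ Filter.Tendsto u' Filter.atTop (nhds 0)

/-- `u` changes sign on `(0,∞)`. -/
def ChangesSign (u : ℝ → ℝ) : Prop :=
  (∃ r : ℝ, 0 < r ∧ u r < 0) ∧ (∃ r : ℝ, 0 < r ∧ 0 < u r)

/-- `z 0 < z 1 < ⋯ < z (k-1)` are exactly the zeros of `u` in `(0,∞)`. -/
def ExactZeros (u : ℝ → ℝ) (k : ℕ) (z : Fin k → ℝ) : Prop :=
  StrictMono z ∧ (∀ i, 0 < z i ∧ u (z i) = 0) ∧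
    ∀ r : ℝ, 0 < r → u r = 0 → ∃ i, r = z i

/-- `u` with derivative `u'` solves `u'' + (d / r) u' + f u = 0` on `(0, ∞)`. -/
structure Sol (d p : ℝ) (u u' : ℝ → ℝ) : Prop where
  deriv1 : ∀ r, 0 < r → HasDerivAt u (u' r) r
  deriv2 : ∀ r, 0 < r → HasDerivAt u' (-(d / r * u' r) - f p (u r)) r

theorem IsSolution.sol {n : ℕ} {p α : ℝ} {u u' u'' : ℝ → ℝ} (h : IsSolution n p α u u' u'') :
    Sol ((n : ℝ) - 1) p u u' where
  deriv1 r hr := (h.hasDeriv1 r hr.le).hasDerivAt (Ici_mem_nhds hr)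
  deriv2 r hr := by
    have h2 := (h.hasDeriv2 r hr.le).hasDerivAt (Ici_mem_nhds hr)
    have h3 := h.ode r hr
    have h4 : -(((n : ℝ) - 1) / r * u' r) - f p (u r) = u'' r := by linear_combination -h3
    rw [h4]
    exact h2

section Calculus

theorem le_of_hasDerivAt_nonneg {h h' : ℝ → ℝ} {a b : ℝ} (hab : a ≤ b)
    (hc : ContinuousOn h (Icc a b)) (hd : ∀ x ∈ Ioo a b, HasDerivAt h (h' x) x)
    (h0 : ∀ x ∈ Ioo a b, 0 ≤ h' x) : h a ≤ h b := by
  rcases hab.eq_or_lt with rfl | hab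
  · rfl
  obtain ⟨c, hc1, hc2⟩ := exists_hasDerivAt_eq_slope h h' hab hc hd
  have := h0 c hc1
  rw [hc2, div_nonneg_iff] at this
  rcases this with h | h <;> linarith [h.1, h.2]

theorem lt_of_hasDerivAt_pos {h h' : ℝ → ℝ} {a b : ℝ} (hab : a < b)
    (hc : ContinuousOn h (Icc a b)) (hd : ∀ x ∈ Ioo a b, HasDerivAt h (h' x) x)
    (h0 : ∀ x ∈ Ioo a b, 0 < h' x) : h a < h b := by
  obtain ⟨c, hc1, hc2⟩ := exists_hasDerivAt_eq_slope h h' hab hc hd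
  have := h0 c hc1
  rw [hc2, div_pos_iff] at this
  rcases this with h | h <;> linarith [h.1, h.2]

/-- A function vanishing at `x` with positive derivative is negative just left of `x`. -/
theorem HasDerivAt.eventually_neg_left {h : ℝ → ℝ} {h' x : ℝ} (hd : HasDerivAt h h' x)
    (h0 : 0 < h') (hx : h x ≤ 0) : ∀ᶠ y in nhdsWithin x (Iio x), h y < 0 := by
  have h1 := (hasDerivAt_iff_tendsto_slope_left_right.1 hd).1
  filter_upwards [h1.eventually (lt_mem_nhds h0), self_mem_nhdsWithin] with y hy1 hy2
  rw [slope_def_field, div_pos_iff] at hy1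
  have : y < x := hy2
  rcases hy1 with h | h <;> linarith [h.1, h.2]

/-- A function that is positive left of `x` and vanishes at `x` cannot have positive
derivative there. -/
theorem not_pos_left_of_hasDerivAt_pos {h : ℝ → ℝ} {h' a x : ℝ} (hax : a < x)
    (hd : HasDerivAt h h' x) (h0 : 0 < h') (hx : h x ≤ 0) (hl : ∀ y ∈ Ioo a x, 0 < h y) :
    False := by
  have h1 := hd.eventually_neg_left h0 hx
  obtain ⟨y, hy1, hy2⟩ := (h1.and (Ioo_mem_nhdsLT hax)).exists
  exact (hl y hy2).not_gt hy1

/-- Continuous induction along `[a, ∞)`. -/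
theorem continuous_induction {P : ℝ → Prop} {a : ℝ}
    (h : ∀ x, a ≤ x → (∀ y ∈ Ico a x, P y) → P x ∧ ∀ᶠ y in nhdsWithin x (Ioi x), P y) :
    ∀ x, a ≤ x → P x := by
  by_contra! hcon
  obtain ⟨b, hab, hb⟩ := hcon
  set s : Set ℝ := {x | a ≤ x ∧ ¬ P x} with hs
  have hne : s.Nonempty := ⟨b, hab, hb⟩
  have hbd : BddBelow s := ⟨a, fun x hx => hx.1⟩
  set c := sInf s with hc
  have hac : a ≤ c := le_csInf hne fun x hx => hx.1
  have hgood : ∀ y ∈ Ico a c, P y := by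
    intro y hy
    by_contra hP
    exact (csInf_le hbd ⟨hy.1, hP⟩).not_gt hy.2
  obtain ⟨h1, h2⟩ := h c hac hgood
  obtain ⟨e, he, h3⟩ := mem_nhdsGT_iff_exists_Ioo_subset.1 h2
  obtain ⟨x, hx, hxe⟩ := exists_lt_of_csInf_lt hne (show sInf s < e from he)
  rcases (csInf_le hbd hx).eq_or_lt with h4 | h4
  · exact hx.2 (h4 ▸ h1)
  · exact hx.2 (h3 ⟨h4, hxe⟩)

/-- A differentiable function with positive derivative on `(0, ∞)` has a differentiable inverse. -/
theorem exists_inverse_hasDerivAt {h h' : ℝ → ℝ} (hd : ∀ t, 0 < t → HasDerivAt h (h' t) t)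
    (h0 : ∀ t, 0 < t → 0 < h' t) :
    ∃ ι : ℝ → ℝ, ∀ t, 0 < t → ι (h t) = t ∧ HasDerivAt ι (h' t)⁻¹ (h t) := by
  have hc : ContinuousOn h (Ioi 0) := fun t ht => (hd t ht).continuousAt.continuousWithinAt
  have hm : StrictMonoOn h (Ioi 0) := by
    intro a ha b hb hab
    exact lt_of_hasDerivAt_pos hab (hc.mono fun x hx => lt_of_lt_of_le ha hx.1)
      (fun x hx => hd x (lt_trans ha hx.1)) fun x hx => h0 x (lt_trans ha hx.1)
  have hl : ∀ t, 0 < t → Function.invFunOn h (Ioi 0) (h t) = t := fun t ht =>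
    hm.injOn.leftInvOn_invFunOn ht
  refine ⟨Function.invFunOn h (Ioi 0), fun t ht => ⟨hl t ht, ?_⟩⟩
  have hs : h '' Ioi 0 ∈ nhds (h t) := by
    have h1 : Icc (h (t / 2)) (h (2 * t)) ⊆ h '' Icc (t / 2) (2 * t) :=
      intermediate_value_Icc (by linarith) (hc.mono fun x hx => by
        have : 0 < t / 2 := by positivity
        exact lt_of_lt_of_le this hx.1)
    refine mem_of_superset (Icc_mem_nhds (hm (by simpa using ht) ht (by linarith))
      (hm ht (by simpa using ht) (by linarith))) (h1.trans (image_mono fun x hx => ?_))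
    have : 0 < t / 2 := by positivity
    exact lt_of_lt_of_le this hx.1
  have hcont : ContinuousAt (Function.invFunOn h (Ioi 0)) (h t) := by
    refine StrictMonoOn.continuousAt_of_image_mem_nhds (s := h '' Ioi 0) ?_ hs ?_
    · rintro _ ⟨a, ha, rfl⟩ _ ⟨b, hb, rfl⟩ hab
      rw [hl a ha, hl b hb]
      exact (hm.lt_iff_lt ha hb).1 hab
    · rw [hl t ht]
      refine mem_of_superset (Ioi_mem_nhds ht) fun x hx => ⟨h x, ⟨x, hx, rfl⟩, hl x hx⟩
  refine HasDerivAt.of_local_left_inverse (f := h) hcont ?_ (h0 t ht).ne' ?_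
  · rw [hl t ht]; exact hd t ht
  · filter_upwards [hs] with y hy
    obtain ⟨x, hx, rfl⟩ := hy
    rw [hl x hx]

/-- Riccati inequalities `ψ' ≥ k (1 + ψ²)` have no global solutions. -/
theorem no_global_riccati {ψ ψ' : ℝ → ℝ} {a k : ℝ} (hk : 0 < k)
    (hd : ∀ r, a ≤ r → HasDerivAt ψ (ψ' r) r) (h : ∀ r, a ≤ r → k * (1 + ψ r ^ 2) ≤ ψ' r) :
    False := by
  have hD : ∀ r, a ≤ r → HasDerivAt (fun r => arctan (ψ r) - k * r)
      (1 / (1 + ψ r ^ 2) * ψ' r - k * 1) r := fun r hr =>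
    (hd r hr).arctan.sub ((hasDerivAt_id r).const_mul k)
  have hmono : ∀ b, a ≤ b → arctan (ψ a) - k * a ≤ arctan (ψ b) - k * b := by
    intro b hb
    refine le_of_hasDerivAt_nonneg (h := fun r => arctan (ψ r) - k * r) hb
      (fun x hx => (hD x hx.1).continuousAt.continuousWithinAt) (fun x hx => hD x hx.1.le) ?_
    intro x hx
    have h1 := h x hx.1.le
    have h2 : 0 < 1 + ψ x ^ 2 := by positivity
    rw [div_mul_eq_mul_div, one_mul, mul_one, sub_nonneg, le_div_iff₀ h2]
    exact h1
  have h1 := hmono (a + π / k + 1) (by have := pi_pos; have : 0 < π / k := by positivity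
                                       linarith)
  have h2 := arctan_lt_pi_div_two (ψ (a + π / k + 1))
  have h3 := neg_pi_div_two_lt_arctan (ψ a)
  have h4 : k * (a + π / k + 1) = k * a + π + k := by field_simp
  linarith

end Calculus

section Nonlinearity

variable {p : ℝ}

theorem f_of_pos {s : ℝ} (hs : 0 < s) : f p s = s * (s ^ (p - 1) - 1) := by
  rw [f, abs_of_pos hs]; ring

theorem f_neg (s : ℝ) : f p (-s) = -f p s := by
  rw [f, f, abs_neg]; ring

theorem continuous_f (hp : 1 < p) : Continuous (f p) := by
  unfold f
  exact continuous_id.neg.add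
    ((continuous_abs.rpow_const fun x => Or.inr (by linarith)).mul continuous_id)

theorem abs_rpow_add_one (hp : 1 < p) (s : ℝ) : |s| ^ (p + 1) = |s| ^ (p - 1) * s ^ 2 := by
  rcases eq_or_ne s 0 with rfl | hs
  · rw [abs_zero, zero_rpow (by linarith)]; simp
  · have h : p + 1 = (p - 1) + (2 : ℕ) := by push_cast; ring
    rw [h, rpow_add_natCast (abs_ne_zero.2 hs), sq_abs]

theorem F_eq (hp : 1 < p) (s : ℝ) : F p s = s ^ 2 * (|s| ^ (p - 1) / (p + 1) - 1 / 2) := by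
  rw [F, abs_rpow_add_one hp]; ring

theorem hasDerivAt_F (hp : 1 < p) (s : ℝ) : HasDerivAt (F p) (f p s) s := by
  have h1 := (hasDerivAt_abs_rpow s (p := p + 1) (by linarith)).div_const (p + 1)
  have h2 := ((hasDerivAt_id s).pow 2).neg.div_const 2
  have h3 := h2.add h1
  have h4 : f p s = -(((2 : ℕ) : ℝ) * id s ^ (2 - 1) * 1) / 2
      + (p + 1) * |s| ^ (p + 1 - 2) * s / (p + 1) := by
    have : p + 1 ≠ 0 := by linarith
    rw [f, show p + 1 - 2 = p - 1 by ring]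
    field_simp
    simp
    ring
  rw [h4]
  exact h3

theorem F_lower (hp : 1 < p) (s : ℝ) : -(1 / 2) ≤ F p s := by
  have h1 := one_add_mul_self_le_rpow_one_add (s := s ^ 2 - 1) (by nlinarith [sq_nonneg s])
    (p := (p + 1) / 2) (by linarith)
  have h2 : (1 + (s ^ 2 - 1)) ^ ((p + 1) / 2) = |s| ^ (p + 1) := by
    rw [show 1 + (s ^ 2 - 1) = |s| ^ (2 : ℝ) by rw [rpow_two, sq_abs]; ring,
      ← rpow_mul (abs_nonneg s)]
    congr 1; ring
  rw [h2] at h1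
  have h3 : (1 + (p + 1) / 2 * (s ^ 2 - 1)) / (p + 1) ≤ |s| ^ (p + 1) / (p + 1) :=
    div_le_div_of_nonneg_right h1 (by linarith)
  have h4 : (1 + (p + 1) / 2 * (s ^ 2 - 1)) / (p + 1) = 1 / (p + 1) + (s ^ 2 - 1) / 2 := by
    field_simp
  have h5 : 0 < 1 / (p + 1) := by have : 0 < p + 1 := by linarith
                                  positivity
  rw [F]
  linarith

theorem one_lt_abs_of_F_nonneg (hp : 1 < p) {s : ℝ} (hs : s ≠ 0) (h : 0 ≤ F p s) :
    1 < |s| := by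
  rw [F_eq hp] at h
  by_contra! h1
  have h2 : |s| ^ (p - 1) ≤ 1 := rpow_le_one (abs_nonneg s) h1 (by linarith)
  have h3 : |s| ^ (p - 1) / (p + 1) < 1 / 2 := by
    rw [div_lt_iff₀ (by linarith)]; linarith
  have h4 : 0 < s ^ 2 := by positivity
  nlinarith

/-- `f` lies beyond a line through `(1, 0)` on any `[v₀, ∞)`, `v₀ > 0`. -/
theorem f_coercive (hp : 1 < p) {v₀ v : ℝ} (h0 : 0 < v₀) (h1 : v₀ ≤ 1) (hv : v₀ ≤ v) :
    v₀ * (p - 1) / p * (v - 1) ^ 2 ≤ f p v * (v - 1) := by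
  have hvp : 0 < v := h0.trans_le hv
  have hfv : f p v = v ^ p - v := by
    rw [f_of_pos hvp, rpow_sub_one hvp.ne']; field_simp
  rw [hfv]
  rcases le_total 1 v with h | h
  · have h2 := one_add_mul_self_le_rpow_one_add (s := v - 1) (by linarith) hp.le
    rw [show 1 + (v - 1) = v by ring] at h2
    have h3 : v₀ * (p - 1) / p ≤ p - 1 := by
      rw [div_le_iff₀ (by linarith)]; nlinarith
    nlinarith [sq_nonneg (v - 1), mul_le_mul_of_nonneg_right h3 (sq_nonneg (v - 1)),
      mul_le_mul_of_nonneg_right h2 (sub_nonneg.2 h)]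
  · have h2 := one_add_mul_self_le_rpow_one_add (s := v⁻¹ - 1) (by
      have : 0 < v⁻¹ := by positivity
      linarith) hp.le
    rw [show 1 + (v⁻¹ - 1) = v⁻¹ by ring, inv_rpow hvp.le] at h2
    have h3 : 0 < v ^ p := rpow_pos_of_pos hvp p
    have h4 : v ^ p * (v + p * (1 - v)) ≤ v := by
      have h5 : v ^ p * v * (1 + p * (v⁻¹ - 1)) ≤ v ^ p * v * (v ^ p)⁻¹ :=
        mul_le_mul_of_nonneg_left h2 (by positivity)
      have h6 : v ^ p * v * (v ^ p)⁻¹ = v := by field_simp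
      have h7 : v ^ p * v * (1 + p * (v⁻¹ - 1)) = v ^ p * (v + p * (1 - v)) := by
        field_simp
      linarith
    have h8 : v ^ p ≤ v := by nlinarith [mul_nonneg h3.le (sub_nonneg.2 h)]
    have h9 : v * ((p - 1) * (1 - v)) ≤ (v - v ^ p) * p := by
      nlinarith [mul_nonneg (sub_nonneg.2 h8) (mul_nonneg (sub_nonneg.2 hp.le) hvp.le)]
    have h10 : v₀ * (p - 1) / p * (1 - v) ≤ v - v ^ p := by
      rw [div_mul_eq_mul_div, div_le_iff₀ (by linarith)]
      nlinarith [mul_nonneg (sub_nonneg.2 hv) (mul_nonneg (sub_nonneg.2 hp.le) (sub_nonneg.2 h))]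
    nlinarith [mul_le_mul_of_nonneg_right h10 (sub_nonneg.2 h)]

end Nonlinearity

namespace Sol

variable {d p : ℝ} {u u' : ℝ → ℝ}

theorem neg (h : Sol d p u u') : Sol d p (fun r => -u r) (fun r => -u' r) where
  deriv1 r hr := (h.deriv1 r hr).neg
  deriv2 r hr := by
    have := (h.deriv2 r hr).neg
    rw [f_neg]
    exact this.congr_deriv (by ring)

theorem continuousOn (h : Sol d p u u') {a b : ℝ} (ha : 0 < a) : ContinuousOn u (Icc a b) :=
  fun x hx => (h.deriv1 x (ha.trans_le hx.1)).continuousAt.continuousWithinAt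

theorem continuousOn' (h : Sol d p u u') {a b : ℝ} (ha : 0 < a) : ContinuousOn u' (Icc a b) :=
  fun x hx => (h.deriv2 x (ha.trans_le hx.1)).continuousAt.continuousWithinAt

theorem hasDerivAt_energy (h : Sol d p u u') (hp : 1 < p) {r : ℝ} (hr : 0 < r) :
    HasDerivAt (fun r => u' r ^ 2 / 2 + F p (u r)) (-(d / r * u' r ^ 2)) r := by
  have h1 := ((h.deriv2 r hr).pow 2).div_const 2
  have h2 := (hasDerivAt_F hp (u r)).comp r (h.deriv1 r hr)
  have h3 := h1.add h2
  exact h3.congr_deriv (by push_cast; ring)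

theorem energy_antitone (h : Sol d p u u') (hp : 1 < p) (hd : 0 ≤ d) {a b : ℝ} (ha : 0 < a)
    (hab : a ≤ b) : u' b ^ 2 / 2 + F p (u b) ≤ u' a ^ 2 / 2 + F p (u a) := by
  have := le_of_hasDerivAt_nonneg (h := fun r => -(u' r ^ 2 / 2 + F p (u r))) hab
    (fun x hx => (h.hasDerivAt_energy hp
      (ha.trans_le hx.1)).neg.continuousAt.continuousWithinAt)
    (fun x hx => (h.hasDerivAt_energy hp (ha.trans hx.1)).neg) (fun x hx => by
      have : 0 < x := ha.trans hx.1
      rw [neg_neg]; positivity)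
  linarith

/-- A solution bounded away from `0` cannot avoid the value `1` eventually. -/
theorem exists_eq_one (h : Sol d p u u') (hp : 1 < p) {v₀ a : ℝ} (h0 : 0 < v₀)
    (hv : ∀ r, a ≤ r → v₀ ≤ u r) : ∃ r, a ≤ r ∧ u r = 1 := by
  by_contra! hne
  set w := min v₀ 1 with hw
  have hw0 : 0 < w := lt_min h0 one_pos
  set c := w * (p - 1) / p with hc
  have hp0 : 0 < p := by linarith
  have hc0 : 0 < c := by have : 0 < p - 1 := by linarith
                         positivity
  set k := min (1 / 2) (c / 2) with hk
  have hk0 : 0 < k := lt_min (by norm_num) (by positivity)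
  set b := max (max a 1) (d ^ 2 / c) with hb
  have hb1 : 1 ≤ b := (le_max_right a 1).trans (le_max_left _ _)
  have hba : a ≤ b := (le_max_left a 1).trans (le_max_left _ _)
  refine no_global_riccati (ψ := fun r => -u' r / (u r - 1)) (a := b)
    (ψ' := fun r => (-(-(d / r * u' r) - f p (u r)) * (u r - 1) - -u' r * u' r) / (u r - 1) ^ 2)
    hk0 ?_ ?_
  · intro r hr
    exact (h.deriv2 r (by linarith)).neg.div ((h.deriv1 r (by linarith)).sub_const 1)
      (sub_ne_zero.2 (hne r (by linarith)))
  · intro r hr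
    have hr0 : 0 < r := by linarith
    have hy : u r - 1 ≠ 0 := sub_ne_zero.2 (hne r (by linarith))
    have hy2 : 0 < (u r - 1) ^ 2 := by positivity
    have h1 := f_coercive hp hw0 (min_le_right _ _)
      ((min_le_left v₀ 1).trans (hv r (by linarith)))
    rw [← hc] at h1
    have h2 : d ^ 2 ≤ c * r ^ 2 := by
      have h3 : d ^ 2 / c ≤ r := (le_max_right _ _).trans hr
      rw [div_le_iff₀ hc0] at h3
      nlinarith [mul_nonneg hc0.le (mul_nonneg hr0.le (sub_nonneg.2 (hb1.trans hr)))]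
    have h4 : (d / r) ^ 2 ≤ c := by
      rw [div_pow, div_le_iff₀ (by positivity)]; exact h2
    have hk1 : k ≤ 1 / 2 := min_le_left _ _
    have hk2 : k ≤ c / 2 := min_le_right _ _
    rw [le_div_iff₀ hy2]
    have h5 : (1 + (-u' r / (u r - 1)) ^ 2) * (u r - 1) ^ 2 = (u r - 1) ^ 2 + u' r ^ 2 := by
      field_simp
    rw [mul_assoc, h5]
    set e := d / r
    set y := u r - 1
    set z := u' r
    have h6 := mul_le_mul_of_nonneg_right hk1 (sq_nonneg z)
    have h7 := mul_le_mul_of_nonneg_right hk2 (sq_nonneg y)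
    have h8 := mul_le_mul_of_nonneg_right h4 (sq_nonneg y)
    nlinarith [sq_nonneg (e * y + z)]

/-- A nontrivial solution has only simple zeros. -/
theorem deriv_ne_zero (h : Sol d p u u') (hp : 1 < p) (hd : 0 ≤ d) {a z : ℝ} (ha : 0 < a)
    (haz : a ≤ z) (hua : u a ≠ 0) (hz : u z = 0) : u' z ≠ 0 := by
  intro hz'
  obtain ⟨M, hM⟩ := isCompact_Icc.exists_bound_of_continuousOn (h.continuousOn ha (b := z))
  set C := 2 * (d / a) + (2 + |M| ^ (p - 1)) with hC
  have hD : ∀ x, 0 < x → HasDerivAt (fun r => (u r ^ 2 + u' r ^ 2) * exp (C * r))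
      ((2 * u x * u' x + 2 * u' x * (-(d / x * u' x) - f p (u x))) * exp (C * x)
        + (u x ^ 2 + u' x ^ 2) * (exp (C * x) * C)) x := by
    intro x hx
    have h1 := ((h.deriv1 x hx).pow 2).add ((h.deriv2 x hx).pow 2)
    have h2 := ((hasDerivAt_id x).const_mul C).exp
    have h3 := h1.mul h2
    exact h3.congr_deriv (by simp)
  have h1 := le_of_hasDerivAt_nonneg (h := fun r => (u r ^ 2 + u' r ^ 2) * exp (C * r)) haz
    (fun x hx => (hD x (ha.trans_le hx.1)).continuousAt.continuousWithinAt)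
    (fun x hx => hD x (ha.trans hx.1)) ?_
  · simp only [hz, hz'] at h1
    have h2 : 0 < (u a ^ 2 + u' a ^ 2) * exp (C * a) := by positivity
    linarith
  · intro x hx
    have hx0 : 0 < x := ha.trans hx.1
    have h2 : |u x| ≤ |M| := (hM x ⟨hx.1.le, hx.2.le⟩).trans (le_abs_self M)
    have h3 : |u x| ^ (p - 1) ≤ |M| ^ (p - 1) :=
      rpow_le_rpow (abs_nonneg _) h2 (by linarith)
    have h3' : 0 ≤ |u x| ^ (p - 1) := by positivity
    have h4 : d / x ≤ d / a := div_le_div_of_nonneg_left hd ha hx.1.le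
    have h5 : 0 ≤ (2 * u x * u' x + 2 * u' x * (-(d / x * u' x) - f p (u x)))
        + (u x ^ 2 + u' x ^ 2) * C := by
      rw [f, hC]
      set m := |u x| ^ (p - 1)
      set y := u x
      set z := u' x
      have h6 := mul_le_mul_of_nonneg_right h4 (sq_nonneg z)
      have h7 : 0 ≤ d / a * y ^ 2 := by positivity
      have h8 := mul_le_mul_of_nonneg_right h3 (add_nonneg (sq_nonneg y) (sq_nonneg z))
      have h9 := mul_nonneg h3' (sq_nonneg (y - z))
      nlinarith [sq_nonneg (y + z)]
    have h6 := mul_nonneg h5 (exp_pos (C * x)).le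
    linarith

end Sol

/-- A continuous function, positive at `a`, stays positive on `[a, ∞)` if it cannot reach zero. -/
theorem pos_of_no_first_zero {φ : ℝ → ℝ} {a : ℝ} (h0 : 0 < φ a)
    (hc : ∀ x, a ≤ x → ContinuousAt φ x)
    (hz : ∀ x, a < x → φ x = 0 → (∀ y ∈ Ico a x, 0 < φ y) → False) :
    ∀ x, a ≤ x → 0 < φ x := by
  refine continuous_induction fun x hax hx => ?_
  have hpos : 0 < φ x := by
    rcases hax.eq_or_lt with rfl | hax'
    · exact h0
    have h1 : 0 ≤ φ x := by
      refine ge_of_tendsto ((hc x hax).tendsto.mono_left (nhdsWithin_le_nhds (s := Iio x))) ?_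
      filter_upwards [Ico_mem_nhdsLT hax'] with y hy using (hx y hy).le
    rcases h1.eq_or_lt with h2 | h2
    · exact (hz x hax' h2.symm hx).elim
    · exact h2
  exact ⟨hpos, ((hc x hax).eventually (lt_mem_nhds hpos)).filter_mono nhdsWithin_le_nhds⟩

theorem F_zero {p : ℝ} (hp : 1 < p) : F p 0 = 0 := by
  rw [F_eq hp]; simp

namespace Sol

variable {d p : ℝ} {u u' : ℝ → ℝ}

/-- A functional along solutions that decreases for large `r` and is nonnegative at zeros of `u`. -/
theorem exists_decreasing_functional (h : Sol d p u u') (hp : 1 < p) (hd : 2 ≤ d) :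
    ∃ (G G' : ℝ → ℝ) (δ r₀ : ℝ), 0 < δ ∧ 1 ≤ r₀ ∧ (∀ r, 0 < r → HasDerivAt G (G' r) r) ∧
      (∀ r, r₀ ≤ r → G' r ≤ -(δ * u r ^ 2)) ∧ ∀ r, 0 ≤ r → u r = 0 → 0 ≤ G r := by
  set b := (1 / (p + 1) + 1 / 2) / 2 with hb
  have hp1 : 0 < 1 / (p + 1) := by have : 0 < p + 1 := by linarith
                                   positivity
  have hp2 : 1 / (p + 1) < 1 / 2 := by
    rw [div_lt_div_iff₀ (by linarith) (by norm_num)]; linarith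
  have hb1 : 1 / (p + 1) < b := by linarith
  have hb2 : b < 1 / 2 := by linarith
  set δ := (1 / 2 - b) / 2 with hδ
  have hδ0 : 0 < δ := by linarith
  set r₀ := max 1 (b * d / (2 * δ)) with hr₀
  have hr1 : 1 ≤ r₀ := le_max_left _ _
  set G : ℝ → ℝ := fun r => r * (u' r ^ 2 / 2 + F p (u r)) + b * (u r * u' r) with hG
  set G' : ℝ → ℝ := fun r => 1 * (u' r ^ 2 / 2 + F p (u r)) + r * (-(d / r * u' r ^ 2))
    + b * (u' r * u' r + u r * (-(d / r * u' r) - f p (u r))) with hG'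
  have hGd : ∀ r, 0 < r → HasDerivAt G (G' r) r := fun r hr =>
    ((hasDerivAt_id r).mul (h.hasDerivAt_energy hp hr)).add
      (((h.deriv1 r hr).mul (h.deriv2 r hr)).const_mul b)
  have hGle : ∀ r, r₀ ≤ r → G' r ≤ -(δ * u r ^ 2) := by
    intro r hr
    have hr0 : 0 < r := by linarith
    have h1 : b * (d / r) ≤ 2 * δ := by
      have h2 : b * d / (2 * δ) ≤ r := (le_max_right _ _).trans hr
      rw [div_le_iff₀ (by linarith)] at h2
      rw [← mul_div_assoc, div_le_iff₀ hr0]; linarith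
    have h0 : 0 ≤ b * (d / r) := by
      have : 0 < b := by linarith
      positivity
    have h3 : F p (u r) - b * (u r * f p (u r)) ≤ -(2 * δ * u r ^ 2) := by
      have h4 : 0 ≤ |u r| ^ (p - 1) * u r ^ 2 := by positivity
      have h5 := mul_le_mul_of_nonneg_left hb1.le h4
      rw [F_eq hp, f, hδ]
      have h6 : |u r| ^ (p - 1) / (p + 1) = |u r| ^ (p - 1) * (1 / (p + 1)) := by ring
      rw [h6]
      nlinarith
    have h6 : r * (-(d / r * u' r ^ 2)) = -(d * u' r ^ 2) := by field_simp
    simp only [hG']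
    rw [h6]
    have h7 : -(b * (d / r)) * (u r * u' r) ≤ δ * (u r ^ 2 + u' r ^ 2) := by
      nlinarith [mul_nonneg h0 (sq_nonneg (u r + u' r)),
        mul_le_mul_of_nonneg_right h1 (add_nonneg (sq_nonneg (u r)) (sq_nonneg (u' r)))]
    nlinarith [mul_le_mul_of_nonneg_right hd (sq_nonneg (u' r)), sq_nonneg (u' r)]
  refine ⟨G, G', δ, r₀, hδ0, hr1, hGd, hGle, fun r hr hur => ?_⟩
  simp only [hG]
  rw [hur, F_zero hp]
  have : 0 ≤ r * (u' r ^ 2 / 2) := by positivity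
  linarith

theorem eventually_ne_zero (h : Sol d p u u') (hp : 1 < p) (hd : 2 ≤ d)
    (hs : ∀ z, 0 < z → u z = 0 → u' z ≠ 0) : ∃ R, 0 < R ∧ ∀ r, R ≤ r → u r ≠ 0 := by
  by_contra! hz
  have hEpos : ∀ r, 0 < r → 0 < u' r ^ 2 / 2 + F p (u r) := by
    intro r hr
    obtain ⟨z, hrz, huz⟩ := hz r hr
    have h1 := h.energy_antitone hp (by linarith) hr hrz
    rw [huz, F_zero hp] at h1
    have h2 := hs z (hr.trans_le hrz) huz
    have : 0 < u' z ^ 2 := by positivity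
    linarith
  have hbig : ∀ R, 0 < R → ∃ c, R ≤ c ∧ 1 < |u c| := by
    intro R hR
    obtain ⟨z₁, h1, hz1⟩ := hz R hR
    obtain ⟨z₂, h2, hz2⟩ := hz (z₁ + 1) (by linarith)
    obtain ⟨c, hc, hc'⟩ := exists_hasDerivAt_eq_zero (f := u) (f' := u') (a := z₁) (b := z₂)
      (by linarith) (h.continuousOn (by linarith)) (by rw [hz1, hz2])
      fun x hx => h.deriv1 x (by linarith [hx.1])
    have h3 := hEpos c (by linarith [hc.1])
    rw [hc'] at h3
    have h4 : 0 < F p (u c) := by simpa using h3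
    refine ⟨c, by linarith [hc.1], one_lt_abs_of_F_nonneg hp ?_ h4.le⟩
    intro h5
    rw [h5, F_zero hp] at h4
    exact h4.false
  obtain ⟨G, G', δ, r₀, hδ0, hr1, hGd, hGle, hG0⟩ := h.exists_decreasing_functional hp hd
  have hGanti : ∀ x y, r₀ ≤ x → x ≤ y → G y ≤ G x := by
    intro x y hx hxy
    have := le_of_hasDerivAt_nonneg (h := fun r => -G r) (h' := fun r => -G' r) hxy
      (fun t ht => (hGd t (by linarith [ht.1])).neg.continuousAt.continuousWithinAt)
      (fun t ht => (hGd t (by linarith [ht.1])).neg) fun t ht => by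
        have := hGle t (by linarith [ht.1])
        have : 0 ≤ δ * u t ^ 2 := by positivity
        linarith
    linarith
  have hGpos : ∀ r, r₀ ≤ r → 0 ≤ G r := by
    intro r hr
    obtain ⟨z, h1, hz1⟩ := hz r (by linarith)
    refine le_trans ?_ (hGanti r z hr h1)
    exact hG0 z (by linarith) hz1
  obtain ⟨M, hM⟩ : ∃ M, M = 2 * (u' 1 ^ 2 / 2 + F p (u 1)) + 1 := ⟨_, rfl⟩
  have hM1 : 1 < M := by linarith [hEpos 1 one_pos]
  have hu'M : ∀ r, 1 ≤ r → |u' r| ≤ M := by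
    intro r hr
    have h1 := h.energy_antitone hp (by linarith) one_pos hr
    have h2 := F_lower hp (u r)
    refine abs_le_of_sq_le_sq ?_ (by linarith)
    nlinarith
  obtain ⟨η, hη⟩ : ∃ η, η = 1 / (2 * M) := ⟨_, rfl⟩
  have hη0 : 0 < η := by rw [hη]; positivity
  have hηM : M * η = 1 / 2 := by rw [hη]; field_simp
  have hdrop : ∀ c, r₀ ≤ c → 1 < |u c| → G (c + η) + δ / 4 * η ≤ G c := by
    intro c hc huc
    have hu4 : ∀ x ∈ Ioo c (c + η), 1 / 4 ≤ u x ^ 2 := by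
      intro x hx
      have h1 := le_of_hasDerivAt_nonneg (h := fun r => M * r + u r)
        (h' := fun r => M * 1 + u' r) hx.1.le
        (fun t ht => (((hasDerivAt_id t).const_mul M).add
          (h.deriv1 t (by linarith [ht.1]))).continuousAt.continuousWithinAt)
        (fun t ht => ((hasDerivAt_id t).const_mul M).add (h.deriv1 t (by linarith [ht.1])))
        fun t ht => by linarith [(abs_le.1 (hu'M t (by linarith [ht.1]))).1]
      have h2 := le_of_hasDerivAt_nonneg (h := fun r => M * r - u r)
        (h' := fun r => M * 1 - u' r) hx.1.le
        (fun t ht => (((hasDerivAt_id t).const_mul M).sub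
          (h.deriv1 t (by linarith [ht.1]))).continuousAt.continuousWithinAt)
        (fun t ht => ((hasDerivAt_id t).const_mul M).sub (h.deriv1 t (by linarith [ht.1])))
        fun t ht => by linarith [(abs_le.1 (hu'M t (by linarith [ht.1]))).2]
      have h3 : M * (x - c) ≤ 1 / 2 := by
        rw [← hηM]; exact mul_le_mul_of_nonneg_left (by linarith [hx.2]) (by linarith)
      rcases lt_abs.1 huc with h4 | h4
      · have : 1 / 2 ≤ u x := by linarith
        nlinarith
      · have : u x ≤ -(1 / 2) := by linarith
        nlinarith
    have := le_of_hasDerivAt_nonneg (h := fun r => -G r - δ / 4 * r)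
      (h' := fun r => -G' r - δ / 4 * 1) (show c ≤ c + η by linarith)
      (fun t ht => ((hGd t (by linarith [ht.1])).neg.sub
        ((hasDerivAt_id t).const_mul (δ / 4))).continuousAt.continuousWithinAt)
      (fun t ht => (hGd t (by linarith [ht.1])).neg.sub ((hasDerivAt_id t).const_mul (δ / 4)))
      fun t ht => by
        have h1 := hGle t (by linarith [ht.1])
        have h2 := mul_le_mul_of_nonneg_left (hu4 t ht) hδ0.le
        linarith
    linarith
  have hiter : ∀ m : ℕ, ∃ r, r₀ ≤ r ∧ G r ≤ G r₀ - m * (δ / 4 * η) := by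
    intro m
    induction m with
    | zero => exact ⟨r₀, le_rfl, by simp⟩
    | succ m ih =>
      obtain ⟨r, hr, hGr⟩ := ih
      obtain ⟨c, hc, huc⟩ := hbig r (by linarith)
      refine ⟨c + η, by linarith, ?_⟩
      have h1 := hdrop c (by linarith) huc
      have h2 := hGanti r c hr hc
      push_cast
      linarith
  obtain ⟨m, hm⟩ := exists_nat_gt (G r₀ / (δ / 4 * η))
  rw [div_lt_iff₀ (by positivity)] at hm
  obtain ⟨r, hr, hGr⟩ := hiter m
  linarith [hGpos r hr]

/-- An eventually positive solution that eventually avoids the value `1` decays. -/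
theorem decaying_of_ne_one (h : Sol d p u u') (hp : 1 < p) (hd : 0 ≤ d) {R : ℝ} (hR : 0 < R)
    (hpos : ∀ r, R ≤ r → 0 < u r) (hne : ∀ r, R ≤ r → u r ≠ 1) : Decaying u u' := by
  have hno : ∀ v₀ a, 0 < v₀ → R ≤ a → (∀ r, a ≤ r → v₀ ≤ u r) → False := by
    intro v₀ a h0 ha hv
    obtain ⟨r, hr, hr1⟩ := h.exists_eq_one hp h0 hv
    exact hne r (ha.trans hr) hr1
  have hcont : ∀ r, R ≤ r → ContinuousAt u r := fun r hr => (h.deriv1 r (by linarith)).continuousAt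
  have hlt : ∀ r, R ≤ r → u r < 1 := by
    rcases lt_or_gt_of_ne (hne R le_rfl) with h1 | h1
    · intro r hr
      have := pos_of_no_first_zero (φ := fun r => 1 - u r) (a := R) (by linarith)
        (fun x hx => continuousAt_const.sub (hcont x hx))
        (fun x hx h0 _ => hne x hx.le (by linarith)) r hr
      linarith
    · refine (hno 1 R one_pos le_rfl fun r hr => ?_).elim
      have := pos_of_no_first_zero (φ := fun r => u r - 1) (a := R) (by linarith)
        (fun x hx => (hcont x hx).sub continuousAt_const)
        (fun x hx h0 _ => hne x hx.le (by linarith)) r hr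
      linarith
  have hfneg : ∀ r, R ≤ r → f p (u r) < 0 := by
    intro r hr
    have h1 : u r ^ (p - 1) < 1 := rpow_lt_one (hpos r hr).le (hlt r hr) (by linarith)
    rw [f_of_pos (hpos r hr)]
    exact mul_neg_of_pos_of_neg (hpos r hr) (by linarith)
  have hu' : ∀ r, R ≤ r → u' r ≤ 0 := by
    by_contra! hcon
    obtain ⟨a, ha, hua⟩ := hcon
    have h1 := pos_of_no_first_zero (φ := u') hua
      (fun x hx => (h.deriv2 x (by linarith)).continuousAt) fun x hx h0 hl => by
        refine not_pos_left_of_hasDerivAt_pos hx (h.deriv2 x (by linarith)) ?_ h0.le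
          fun y hy => hl y ⟨hy.1.le, hy.2⟩
        rw [h0]
        linarith [hfneg x (by linarith)]
    refine hno (u a) a (hpos a ha) ha fun r hr => ?_
    exact le_of_hasDerivAt_nonneg hr (h.continuousOn (by linarith))
      (fun x hx => h.deriv1 x (by linarith [hx.1])) fun x hx => (h1 x hx.1.le).le
  have hanti : ∀ a b, R ≤ a → a ≤ b → u b ≤ u a := by
    intro a b ha hab
    have := le_of_hasDerivAt_nonneg (h := fun r => -u r) (h' := fun r => -u' r) hab
      (h.continuousOn (by linarith)).neg
      (fun x hx => (h.deriv1 x (by linarith [hx.1])).neg)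
      fun x hx => by linarith [hu' x (by linarith [hx.1])]
    linarith
  have hu0 : Tendsto u atTop (nhds 0) := by
    rw [tendsto_order]
    refine ⟨fun a ha => ?_, fun ε hε => ?_⟩
    · filter_upwards [eventually_ge_atTop R] with r hr using ha.trans (hpos r hr)
    · by_contra hcon
      refine hno ε R hε le_rfl fun r hr => ?_
      by_contra! hr1
      refine hcon ?_
      filter_upwards [eventually_ge_atTop r] with x hx
      exact (hanti r x hr hx).trans_lt hr1
  refine ⟨hu0, ?_⟩
  have h1 : Tendsto (fun r => u r - u (r + -1)) atTop (nhds 0) := by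
    simpa using hu0.sub (hu0.comp (tendsto_atTop_add_const_right atTop (-1) tendsto_id))
  refine tendsto_of_tendsto_of_tendsto_of_le_of_le' h1 tendsto_const_nhds ?_ ?_
  · filter_upwards [eventually_ge_atTop (R + 1)] with r hr
    have hmono : ∀ x ∈ Ioo (r + -1) r, u' x ≤ u' r := fun x hx =>
      le_of_hasDerivAt_nonneg hx.2.le (h.continuousOn' (by linarith [hx.1]))
        (fun y hy => h.deriv2 y (by linarith [hx.1, hy.1])) fun y hy => by
          have h2 := hu' y (by linarith [hx.1, hy.1])
          have h3 := hfneg y (by linarith [hx.1, hy.1])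
          have h4 : 0 < y := by linarith [hx.1, hy.1]
          have h5 : d / y * u' y ≤ 0 := mul_nonpos_of_nonneg_of_nonpos (by positivity) h2
          linarith
    have := le_of_hasDerivAt_nonneg (h := fun x => u' r * x - u x)
      (h' := fun x => u' r * 1 - u' x) (show r + -1 ≤ r by linarith)
      (fun x hx => (((hasDerivAt_id x).const_mul (u' r)).sub
        (h.deriv1 x (by linarith [hx.1]))).continuousAt.continuousWithinAt)
      (fun x hx => ((hasDerivAt_id x).const_mul (u' r)).sub (h.deriv1 x (by linarith [hx.1])))
      fun x hx => by linarith [hmono x hx]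
    linarith
  · filter_upwards [eventually_ge_atTop R] with r hr using hu' r hr

end Sol

namespace IsSolution

variable {n : ℕ} {p α : ℝ} {u u' u'' : ℝ → ℝ}

theorem tendsto_zero (h : IsSolution n p α u u' u'') :
    Tendsto u (nhdsWithin 0 (Ioi 0)) (nhds α) := by
  have := (h.hasDeriv1 0 self_mem_Ici).continuousWithinAt.tendsto
  rw [h.init] at this
  exact this.mono_left (nhdsWithin_mono 0 Ioi_subset_Ici_self)

theorem tendsto_deriv_zero (h : IsSolution n p α u u' u'') :
    Tendsto u' (nhdsWithin 0 (Ioi 0)) (nhds 0) := by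
  have := (h.hasDeriv2 0 self_mem_Ici).continuousWithinAt.tendsto
  rw [h.initDeriv] at this
  exact this.mono_left (nhdsWithin_mono 0 Ioi_subset_Ici_self)

theorem tendsto_deriv_div (h : IsSolution n p α u u' u'') (hp : 1 < p) (hn : n ≠ 0) :
    Tendsto (fun r => u' r / r) (nhdsWithin 0 (Ioi 0)) (nhds (-f p α / n)) := by
  have h1 : Tendsto (fun r => u' r / r) (nhdsWithin 0 (Ioi 0)) (nhds (u'' 0)) := by
    have h2 := hasDerivWithinAt_iff_tendsto_slope.1 (h.hasDeriv2 0 self_mem_Ici)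
    rw [Ici_sdiff_left] at h2
    refine h2.congr fun r => ?_
    rw [slope_def_field, h.initDeriv]; simp
  have h3 : Tendsto u'' (nhdsWithin 0 (Ioi 0)) (nhds (u'' 0)) :=
    (h.cont2 0 self_mem_Ici).tendsto.mono_left (nhdsWithin_mono 0 Ioi_subset_Ici_self)
  have h4 := ((continuous_f hp).tendsto α).comp h.tendsto_zero
  have h5 : Tendsto (fun r => u'' r + ((n : ℝ) - 1) * (u' r / r) + f p (u r))
      (nhdsWithin 0 (Ioi 0)) (nhds (u'' 0 + ((n : ℝ) - 1) * u'' 0 + f p α)) :=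
    (h3.add (h1.const_mul _)).add h4
  have h6 : u'' 0 + ((n : ℝ) - 1) * u'' 0 + f p α = 0 := by
    refine tendsto_nhds_unique (h5.congr' ?_) tendsto_const_nhds
    filter_upwards [self_mem_nhdsWithin] with r hr
    rw [← h.ode r hr]; ring
  have h7 : u'' 0 = -f p α / n := by
    have : (n : ℝ) ≠ 0 := Nat.cast_ne_zero.2 hn
    field_simp
    linarith
  rwa [h7] at h1

theorem deriv_ne_zero (h : IsSolution n p α u u' u'') (hp : 1 < p) (hn : 1 ≤ n) (hα : 0 < α)
    {z : ℝ} (hz : 0 < z) (huz : u z = 0) : u' z ≠ 0 := by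
  obtain ⟨a, h1, h2⟩ := ((h.tendsto_zero.eventually (lt_mem_nhds hα)).and
    (Ioo_mem_nhdsGT hz)).exists
  have : (1 : ℝ) ≤ n := by exact_mod_cast hn
  exact h.sol.deriv_ne_zero hp (by linarith) h2.1 h2.2.le h1.ne' huz

theorem finite_zeros (h : IsSolution n p α u u' u'') (hp : 1 < p) (hn : 3 ≤ n) (hα : 0 < α) :
    {r : ℝ | 0 < r ∧ u r = 0}.Finite := by
  have hs : ∀ z, 0 < z → u z = 0 → u' z ≠ 0 := fun z hz huz =>
    h.deriv_ne_zero hp (by omega) hα hz huz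
  have hn' : (3 : ℝ) ≤ n := by exact_mod_cast hn
  obtain ⟨R, hR, hR'⟩ := h.sol.eventually_ne_zero hp (by linarith) hs
  obtain ⟨e, he, he'⟩ := mem_nhdsGT_iff_exists_Ioo_subset.1
    (h.tendsto_zero.eventually (lt_mem_nhds hα))
  have he0 : 0 < e := he
  by_contra hinf
  obtain ⟨x, hx, hacc⟩ := Set.Infinite.exists_accPt_of_subset_isCompact hinf
    (isCompact_Icc (a := e) (b := R)) fun r hr => by
      constructor
      · by_contra! hre
        have : 0 < u r := he' ⟨hr.1, hre⟩
        exact this.ne' hr.2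
      · by_contra! hre
        exact hR' r hre.le hr.2
  have hx0 : 0 < x := he0.trans_le hx.1
  have hev : ∀ᶠ y in nhdsWithin x {x}ᶜ, u y ≠ 0 := by
    by_cases hux : u x = 0
    · exact (h.sol.deriv1 x hx0).eventually_ne (hs x hx0 hux)
    · exact ((h.sol.deriv1 x hx0).continuousAt.eventually_ne hux).filter_mono nhdsWithin_le_nhds
  rw [accPt_iff_frequently_nhdsNE] at hacc
  obtain ⟨y, hy1, hy2⟩ := (hacc.and_eventually hev).exists
  exact hy2 hy1.2

theorem changesSign (h : IsSolution n p α u u' u'') (hp : 1 < p) (hn : 1 ≤ n) (hα : 0 < α)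
    {z : ℝ} (hz : 0 < z) (huz : u z = 0) : ChangesSign u := by
  have hz' := h.deriv_ne_zero hp hn hα hz huz
  refine ⟨?_, ?_⟩
  · have hd := h.sol.deriv1 z hz
    rcases lt_or_gt_of_ne hz' with h1 | h1
    · by_contra! hcon
      have hmin : IsLocalMin u z := by
        filter_upwards [Ioi_mem_nhds hz] with x hx
        rw [huz]; exact hcon x hx
      exact hz' (hmin.hasDerivAt_eq_zero hd)
    · obtain ⟨y, hy1, hy2⟩ := ((hd.eventually_neg_left h1 huz.le).and (Ioo_mem_nhdsLT hz)).exists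
      exact ⟨y, hy2.1, hy1⟩
  · obtain ⟨a, h1, h2⟩ := ((h.tendsto_zero.eventually (lt_mem_nhds hα)).and
      self_mem_nhdsWithin).exists
    exact ⟨a, h2, h1⟩

/-- A solution without zeros beyond `a` decays, or oscillates about `1` or about `-1`. -/
theorem decaying_or_oscillates (h : IsSolution n p α u u' u'') (hp : 1 < p) (hn : 1 ≤ n) {a : ℝ}
    (ha : 0 < a) (hz : ∀ r, a < r → u r ≠ 0) :
    Decaying u u' ∨ {r : ℝ | a < r ∧ u r = 1}.Infinite ∨ {r : ℝ | a < r ∧ u r = -1}.Infinite := by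
  by_contra! hcon
  obtain ⟨h0, h1, h2⟩ := hcon
  obtain ⟨M₁, hM₁⟩ := h1.bddAbove
  obtain ⟨M₂, hM₂⟩ := h2.bddAbove
  have hn' : (1 : ℝ) ≤ n := by exact_mod_cast hn
  set R := max a (max M₁ M₂) + 1 with hR
  have hRa : a < R := by linarith [le_max_left a (max M₁ M₂)]
  have hR1 : M₁ < R := by linarith [le_max_right a (max M₁ M₂), le_max_left M₁ M₂]
  have hR2 : M₂ < R := by linarith [le_max_right a (max M₁ M₂), le_max_right M₁ M₂]
  have hne1 : ∀ r, R ≤ r → u r ≠ 1 := fun r hr hur => by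
    linarith [hM₁ (show r ∈ {r : ℝ | a < r ∧ u r = 1} from ⟨by linarith, hur⟩)]
  have hne2 : ∀ r, R ≤ r → u r ≠ -1 := fun r hr hur => by
    linarith [hM₂ (show r ∈ {r : ℝ | a < r ∧ u r = -1} from ⟨by linarith, hur⟩)]
  rcases lt_or_gt_of_ne (hz R hRa) with h3 | h3
  · have hpos := pos_of_no_first_zero (φ := fun r => -u r) (a := R) (by linarith)
      (fun x hx => (h.sol.deriv1 x (by linarith)).neg.continuousAt)
      fun x hx hux _ => hz x (by linarith) (by linarith)
    have hdec := h.sol.neg.decaying_of_ne_one hp (by linarith) (R := R) (by linarith) hpos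
      fun r hr hur => hne2 r hr (by linarith)
    refine h0 ⟨?_, ?_⟩
    · simpa using hdec.1.neg
    · simpa using hdec.2.neg
  · have hpos := pos_of_no_first_zero (φ := u) (a := R) h3
      (fun x hx => (h.sol.deriv1 x (by linarith)).continuousAt)
      fun x hx hux _ => hz x (by linarith) hux
    exact h0 (h.sol.decaying_of_ne_one hp (by linarith) (by linarith) hpos hne1)

theorem exists_exactZeros (h : IsSolution n p α u u' u'') (hp : 1 < p) (hn : 3 ≤ n) (hα : 0 < α)
    {z : ℝ} (hz : 0 < z) (huz : u z = 0) :
    ∃ (m : ℕ) (z : Fin (m + 1) → ℝ), ExactZeros u (m + 1) z ∧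
      (Decaying u u' ∨ {r : ℝ | z (Fin.last m) < r ∧ u r = 1}.Infinite ∨
        {r : ℝ | z (Fin.last m) < r ∧ u r = -1}.Infinite) := by
  set Z := (h.finite_zeros hp hn hα).toFinset with hZ
  have hmem : ∀ r, r ∈ Z ↔ 0 < r ∧ u r = 0 := fun r => by simp [hZ]
  have hk : 0 < Z.card := Finset.card_pos.2 ⟨z, (hmem z).2 ⟨hz, huz⟩⟩
  obtain ⟨m, hm⟩ := Nat.exists_eq_add_of_lt hk
  rw [zero_add] at hm
  set ζ := Z.orderEmbOfFin hm with hζ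
  have hsurj : ∀ r, 0 < r → u r = 0 → ∃ i, r = ζ i := fun r hr hur => by
    have h1 : r ∈ Set.range ζ := by
      rw [hζ, Finset.range_orderEmbOfFin]
      exact (hmem r).2 ⟨hr, hur⟩
    obtain ⟨i, hi⟩ := h1
    exact ⟨i, hi.symm⟩
  have hζ0 : ∀ i, 0 < ζ i ∧ u (ζ i) = 0 := fun i => (hmem _).1 (Z.orderEmbOfFin_mem hm i)
  refine ⟨m, ζ, ⟨ζ.strictMono, hζ0, hsurj⟩,
    h.decaying_or_oscillates hp (by omega) (hζ0 _).1 fun r hr hur => ?_⟩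
  obtain ⟨i, rfl⟩ := hsurj r ((hζ0 _).1.trans hr) hur
  exact (ζ.strictMono.lt_iff_lt.1 hr).not_ge (Fin.le_last i)

end IsSolution

/-- The logarithmic slope `-r u'(r) / u(r)`. -/
noncomputable def logSlope (u u' : ℝ → ℝ) (r : ℝ) : ℝ := -(r * u' r / u r)

/-- `r` times the derivative of the logarithmic slope of a solution. -/
noncomputable def slopeRate (d p : ℝ) (u u' : ℝ → ℝ) (r : ℝ) : ℝ :=
  logSlope u u' r ^ 2 - (d - 1) * logSlope u u' r + r ^ 2 * (u r ^ (p - 1) - 1)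

theorem Sol.hasDerivAt_logSlope {d p : ℝ} {u u' : ℝ → ℝ} (h : Sol d p u u') {r : ℝ} (hr : 0 < r)
    (hu : 0 < u r) : HasDerivAt (logSlope u u') (slopeRate d p u u' r / r) r := by
  have h1 := (((hasDerivAt_id r).mul (h.deriv2 r hr)).div (h.deriv1 r hr) hu.ne').neg
  refine h1.congr_deriv ?_
  rw [slopeRate, logSlope, f_of_pos hu]
  simp only [id, Pi.mul_apply]
  field_simp
  ring

/-- The properties of a ground state that enter the comparison argument. -/
structure Ground (d p α : ℝ) (g g' : ℝ → ℝ) : Prop where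
  sol : Sol d p g g'
  pos : ∀ r, 0 < r → 0 < g r
  deriv_neg : ∀ r, 0 < r → g' r < 0
  one_lt : 1 < α
  energy_nonneg : ∀ r, 0 < r → 0 ≤ g' r ^ 2 / 2 + F p (g r)
  slopeRate_pos : ∀ r, 0 < r → 0 < slopeRate d p g g' r
  tendsto_zero : Tendsto g (nhdsWithin 0 (Ioi 0)) (nhds α)
  tendsto_deriv_div : Tendsto (fun r => g' r / r) (nhdsWithin 0 (Ioi 0)) (nhds (-f p α / (d + 1)))
  tendsto_atTop : Tendsto g atTop (nhds 0)

theorem Sol.hasDerivAt_pohozaev {k : ℕ} {p : ℝ} {u u' : ℝ → ℝ} (h : Sol ((k : ℝ) + 2) p u u')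
    (hp : 1 < p) {r : ℝ} (hr : 0 < r) (hu : 0 < u r) :
    HasDerivAt (fun r => r ^ (k + 3) * (u' r ^ 2 / 2 + F p (u r))
      + ((k : ℝ) + 1) / 2 * (r ^ (k + 2) * (u r * u' r)))
      (r ^ (k + 2) * (u r ^ 2 * ((((k : ℝ) + 3) / (p + 1) - ((k : ℝ) + 1) / 2) * u r ^ (p - 1) - 1)))
      r := by
  have h1 := ((hasDerivAt_pow (k + 3) r).mul (h.hasDerivAt_energy hp hr)).add
    (((hasDerivAt_pow (k + 2) r).mul ((h.deriv1 r hr).mul (h.deriv2 r hr))).const_mul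
      (((k : ℝ) + 1) / 2))
  refine h1.congr_deriv ?_
  have h2 : k + 3 - 1 = k + 2 := rfl
  have h3 : k + 2 - 1 = k + 1 := rfl
  have h4 : p + 1 ≠ 0 := by linarith
  simp only [h2, h3, Pi.mul_apply]
  rw [F_eq hp, f_of_pos hu, abs_of_pos hu, pow_succ r (k + 2), pow_succ r (k + 1)]
  push_cast
  field_simp
  ring

namespace IsSolution

variable {n : ℕ} {p α : ℝ} {u u' u'' : ℝ → ℝ}

theorem eventually_deriv_neg (h : IsSolution n p α u u' u'') (hp : 1 < p) (hn : n ≠ 0)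
    (hα : 1 < α) : ∀ᶠ r in nhdsWithin 0 (Ioi 0), u' r < 0 := by
  have h1 : 0 < f p α := by
    rw [f_of_pos (by linarith)]
    have := one_lt_rpow hα (show 0 < p - 1 by linarith)
    exact mul_pos (by linarith) (by linarith)
  have h2 : -f p α / n < 0 := div_neg_of_neg_of_pos (by linarith) (by positivity)
  filter_upwards [(h.tendsto_deriv_div hp hn).eventually (gt_mem_nhds h2), self_mem_nhdsWithin]
    with r h3 h4
  have h5 : 0 < r := h4
  by_contra! h6
  exact h3.not_ge (by positivity)

theorem ground (h : IsSolution n p α u u' u'') (hp : 1 < p) (hn : 3 ≤ n)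
    (hp2 : p < ((n : ℝ) + 2) / ((n : ℝ) - 2)) (hdec : Decaying u u') (hpos : ∀ r, 0 ≤ r → 0 < u r) :
    Ground ((n : ℝ) - 1) p α u u' := by
  obtain ⟨k, rfl⟩ : ∃ k, n = k + 3 := ⟨n - 3, by omega⟩
  have hs := h.sol
  have hd : (((k + 3 : ℕ) : ℝ) - 1) = (k : ℝ) + 2 := by push_cast; ring
  rw [hd] at hs ⊢
  have hk : (0 : ℝ) ≤ k := k.cast_nonneg
  have hFc : Continuous (F p) := by
    refine continuous_iff_continuousAt.2 fun s => (hasDerivAt_F hp s).continuousAt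
  have hα : 0 < α := by rw [← h.init]; exact hpos 0 le_rfl
  have hE : ∀ r, 0 < r → 0 ≤ u' r ^ 2 / 2 + F p (u r) := by
    intro r hr
    have h1 : Tendsto (fun r => u' r ^ 2 / 2 + F p (u r)) atTop (nhds 0) := by
      have := ((hdec.2.pow 2).div_const 2).add ((hFc.tendsto 0).comp hdec.1)
      simpa [F_zero hp] using this
    refine le_of_tendsto h1 ?_
    filter_upwards [eventually_ge_atTop r] with x hx
    exact hs.energy_antitone hp (by linarith) hr hx
  have hE0 : Tendsto (fun r => u' r ^ 2 / 2 + F p (u r)) (nhdsWithin 0 (Ioi 0)) (nhds (F p α)) := by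
    have := ((h.tendsto_deriv_zero.pow 2).div_const 2).add ((hFc.tendsto α).comp h.tendsto_zero)
    simpa using this
  have hα1 : 1 < α := by
    have h1 : 0 ≤ F p α := by
      refine ge_of_tendsto hE0 ?_
      filter_upwards [self_mem_nhdsWithin] with r hr using hE r hr
    have := one_lt_abs_of_F_nonneg hp hα.ne' h1
    rwa [abs_of_pos hα] at this
  have hneg : ∀ r, 0 < r → u' r < 0 := by
    obtain ⟨e, he, he'⟩ := mem_nhdsGT_iff_exists_Ioo_subset.1
      (h.eventually_deriv_neg hp (by omega) hα1)
    have he0 : 0 < e := he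
    intro r hr
    rcases lt_or_ge r e with hre | hre
    · exact he' ⟨hr, hre⟩
    have h1 : u' (e / 2) < 0 := he' ⟨by linarith, by linarith⟩
    have h2 := pos_of_no_first_zero (φ := fun r => -u' r) (a := e / 2) (by linarith)
      (fun x hx => (hs.deriv2 x (by linarith)).neg.continuousAt) (fun x hx hx0 hl => by
        have hxp : 0 < x := by linarith
        have h0 : u' x = 0 := by linarith
        refine not_pos_left_of_hasDerivAt_pos hx (hs.deriv2 x hxp).neg ?_ hx0.le
          fun y hy => hl y ⟨hy.1.le, hy.2⟩
        have h3 := hE x hxp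
        rw [h0] at h3
        have h4 := one_lt_abs_of_F_nonneg hp (hpos x hxp.le).ne' (by simpa using h3)
        rw [abs_of_pos (hpos x hxp.le)] at h4
        have h5 := one_lt_rpow h4 (show 0 < p - 1 by linarith)
        rw [h0, f_of_pos (hpos x hxp.le)]
        have := mul_pos (hpos x hxp.le) (sub_pos.2 h5)
        linarith) r (by linarith)
    linarith
  have hanti : ∀ a b, 0 < a → a < b → u b < u a := by
    intro a b ha hab
    have := lt_of_hasDerivAt_pos (h := fun r => -u r) (h' := fun r => -u' r) hab
      (hs.continuousOn ha).neg (fun x hx => (hs.deriv1 x (by linarith [hx.1])).neg)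
      fun x hx => by linarith [hneg x (by linarith [hx.1])]
    linarith
  have hH := fun r (hr : 0 < r) => hs.hasDerivAt_pohozaev hp hr (hpos r hr.le)
  obtain ⟨H, hHdef⟩ : ∃ H : ℝ → ℝ, H = fun r => r ^ (k + 3) * (u' r ^ 2 / 2 + F p (u r))
      + ((k : ℝ) + 1) / 2 * (r ^ (k + 2) * (u r * u' r)) := ⟨_, rfl⟩
  obtain ⟨A, hA⟩ : ∃ A : ℝ, A = ((k : ℝ) + 3) / (p + 1) - ((k : ℝ) + 1) / 2 := ⟨_, rfl⟩
  rw [← hHdef, ← hA] at hH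
  have hA0 : 0 < A := by
    push_cast at hp2
    rw [lt_div_iff₀ (by linarith)] at hp2
    rw [hA, sub_pos, div_lt_div_iff₀ (by norm_num) (by linarith)]
    linarith
  have hyanti : ∀ a b, 0 < a → a < b → u b ^ (p - 1) < u a ^ (p - 1) := fun a b ha hab =>
    rpow_lt_rpow (hpos b (by linarith)).le (hanti a b ha hab) (by linarith)
  have hHpos : ∀ r, 0 < r → 0 < H r := by
    intro r hr
    rcases le_or_gt 1 (A * u r ^ (p - 1)) with hc | hc
    · have hinc : ∀ a b, 0 < a → a < b → b ≤ r → H a < H b := by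
        intro a b ha hab hb
        refine lt_of_hasDerivAt_pos hab (fun x hx => (hH x
          (ha.trans_le hx.1)).continuousAt.continuousWithinAt) (fun x hx => hH x (ha.trans hx.1))
          fun x hx => ?_
        have hx0 : 0 < x := ha.trans hx.1
        have h1 := mul_lt_mul_of_pos_left (hyanti x r hx0 (by linarith [hx.2])) hA0
        have h2 := hpos x hx0.le
        exact mul_pos (by positivity) (mul_pos (by positivity) (by linarith))
      have h0 : Tendsto H (nhdsWithin 0 (Ioi 0)) (nhds 0) := by
        have hr0 : Tendsto (fun r : ℝ => r) (nhdsWithin 0 (Ioi 0)) (nhds 0) :=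
          tendsto_id.mono_left nhdsWithin_le_nhds
        have := ((hr0.pow (k + 3)).mul hE0).add (((hr0.pow (k + 2)).mul
          (h.tendsto_zero.mul h.tendsto_deriv_zero)).const_mul (((k : ℝ) + 1) / 2))
        rw [hHdef]
        simpa using this
      have h1 : 0 ≤ H (r / 2) := by
        refine le_of_tendsto h0 ?_
        filter_upwards [Ioo_mem_nhdsGT (show 0 < r / 2 by positivity)] with x hx
        exact (hinc x (r / 2) hx.1 hx.2 (by linarith)).le
      exact h1.trans_lt (hinc (r / 2) r (by linarith) (by linarith) le_rfl)
    · have hdec' : ∀ a b, r ≤ a → a < b → H b < H a := by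
        intro a b ha hab
        have := lt_of_hasDerivAt_pos (h := fun r => -H r) hab
          (fun x hx => (hH x (by linarith [hx.1])).neg.continuousAt.continuousWithinAt)
          (fun x hx => (hH x (by linarith [hx.1])).neg) fun x hx => by
          have hx0 : 0 < x := by linarith [hx.1]
          have h1 := mul_lt_mul_of_pos_left (hyanti r x hr (by linarith [hx.1])) hA0
          have h2 := hpos x hx0.le
          rw [← mul_neg, ← mul_neg]
          exact mul_pos (by positivity) (mul_pos (by positivity) (by linarith))
        linarith
      obtain ⟨X, hX⟩ := (hdec.1.eventually (gt_mem_nhds one_pos)).exists_forall_of_atTop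
      set Y := max X 1 with hY
      have hY1 : 1 ≤ Y := le_max_right _ _
      have hflux : ∀ x, Y ≤ x → Y ^ (k + 2) * u' Y ≤ x ^ (k + 2) * u' x := by
        intro x hx
        have hD : ∀ t, 0 < t → HasDerivAt (fun t => t ^ (k + 2) * u' t)
            (-(t ^ (k + 2) * f p (u t))) t := fun t ht => by
          refine ((hasDerivAt_pow (k + 2) t).mul (hs.deriv2 t ht)).congr_deriv ?_
          have h3 : k + 2 - 1 = k + 1 := rfl
          rw [h3, pow_succ t (k + 1)]
          push_cast
          field_simp
          ring
        refine le_of_hasDerivAt_nonneg (h := fun t => t ^ (k + 2) * u' t) hx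
          (fun t ht => (hD t (by linarith [ht.1])).continuousAt.continuousWithinAt)
          (fun t ht => hD t (by linarith [ht.1])) fun t ht => ?_
        have ht0 : 0 < t := by linarith [ht.1]
        have h1 := hX t ((le_max_left X 1).trans ht.1.le)
        have h2 : u t ^ (p - 1) < 1 := rpow_lt_one (hpos t ht0.le).le h1 (by linarith)
        rw [f_of_pos (hpos t ht0.le), ← mul_neg, ← mul_neg]
        have := hpos t ht0.le
        exact (mul_pos (by positivity) (mul_pos this (by linarith))).le
      have h1 : 0 ≤ H (r + 1) := by
        have h2 : Tendsto (fun x => ((k : ℝ) + 1) / 2 * (Y ^ (k + 2) * u' Y) * u x) atTop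
            (nhds 0) := by simpa using hdec.1.const_mul (((k : ℝ) + 1) / 2 * (Y ^ (k + 2) * u' Y))
        refine le_of_tendsto h2 ?_
        filter_upwards [eventually_gt_atTop (r + 1), eventually_ge_atTop Y] with x hx1 hx2
        refine le_trans ?_ (hdec' (r + 1) x (by linarith) hx1).le
        have hx0 : 0 < x := by linarith
        have h3 : 0 ≤ x ^ (k + 3) * (u' x ^ 2 / 2 + F p (u x)) :=
          mul_nonneg (by positivity) (hE x hx0)
        have h4 := mul_le_mul_of_nonneg_right (hflux x hx2) (mul_nonneg (show
          0 ≤ ((k : ℝ) + 1) / 2 by positivity) (hpos x hx0.le).le)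
        simp only [hHdef]
        linarith
      exact h1.trans_lt (hdec' r (r + 1) le_rfl (by linarith))
  refine ⟨hs, fun r hr => hpos r hr.le, hneg, hα1, hE, fun r hr => ?_, h.tendsto_zero, ?_, hdec.1⟩
  · have hu := hpos r hr.le
    have h1 : r ^ (k + 1) * (u r ^ 2 * slopeRate ((k : ℝ) + 2) p u u' r)
        = 2 * H r + r ^ (k + 3) * (u r ^ 2 * u r ^ (p - 1) * ((p - 1) / (p + 1))) := by
      have h4 : p + 1 ≠ 0 := by linarith
      simp only [slopeRate, logSlope, hHdef]
      rw [F_eq hp, abs_of_pos hu, pow_succ r (k + 2), pow_succ r (k + 1)]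
      field_simp
      ring
    have h2 : 0 ≤ r ^ (k + 3) * (u r ^ 2 * u r ^ (p - 1) * ((p - 1) / (p + 1))) := by
      have : 0 < (p - 1) / (p + 1) := div_pos (by linarith) (by linarith)
      positivity
    have h3 : 0 < r ^ (k + 1) * (u r ^ 2 * slopeRate ((k : ℝ) + 2) p u u' r) := by
      rw [h1]; linarith [hHpos r hr]
    have h5 : 0 < r ^ (k + 1) * u r ^ 2 := by positivity
    rw [← mul_assoc] at h3
    exact pos_of_mul_pos_right h3 h5.le
  · have := h.tendsto_deriv_div hp (by omega)
    push_cast at this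
    rwa [show (k : ℝ) + 2 + 1 = (k : ℝ) + 3 by ring]

end IsSolution

theorem pos_of_no_first_zero_Ico {φ : ℝ → ℝ} {a b : ℝ} (h0 : 0 < φ a)
    (hc : ∀ x ∈ Ico a b, ContinuousAt φ x)
    (hz : ∀ x ∈ Ioo a b, φ x = 0 → (∀ y ∈ Ico a x, 0 < φ y) → False) :
    ∀ x ∈ Ico a b, 0 < φ x := by
  have key : ∀ x, a ≤ x → x < b → 0 < φ x := by
    refine continuous_induction fun x hax hx => ?_
    rcases le_or_gt b x with hbx | hbx
    · refine ⟨fun h => absurd h hbx.not_gt, ?_⟩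
      filter_upwards [self_mem_nhdsWithin] with y hy h
      exact absurd (h.trans_le hbx) (not_lt_of_gt hy)
    have hx' : ∀ y ∈ Ico a x, 0 < φ y := fun y hy => hx y hy (hy.2.trans hbx)
    have hpos : 0 < φ x := by
      rcases hax.eq_or_lt with rfl | hax'
      · exact h0
      have h1 : 0 ≤ φ x := by
        refine ge_of_tendsto ((hc x ⟨hax, hbx⟩).tendsto.mono_left
          (nhdsWithin_le_nhds (s := Iio x))) ?_
        filter_upwards [Ico_mem_nhdsLT hax'] with y hy using (hx' y hy).le
      rcases h1.eq_or_lt with h2 | h2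
      · exact (hz x ⟨hax', hbx⟩ h2.symm hx').elim
      · exact h2
    refine ⟨fun _ => hpos, ?_⟩
    filter_upwards [((hc x ⟨hax, hbx⟩).eventually (lt_mem_nhds hpos)).filter_mono
      nhdsWithin_le_nhds] with y hy _ using hy
  exact fun x hx => key x hx.1 hx.2

/-- A function tending to `0` at `0` is positive if its derivative is positive at each zero, and
near `0` also wherever the function is nonpositive. -/
theorem pos_of_tendsto_zero {L L' : ℝ → ℝ} {c e : ℝ} (he : 0 < e)
    (hd : ∀ x ∈ Ioo 0 c, HasDerivAt L (L' x) x)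
    (h0 : ∀ x ∈ Ioo 0 c, L x = 0 → 0 < L' x)
    (h1 : ∀ x ∈ Ioo 0 c, x < e → L x ≤ 0 → 0 < L' x)
    (hl : Tendsto L (nhdsWithin 0 (Ioi 0)) (nhds 0)) : ∀ x ∈ Ioo 0 c, 0 < L x := by
  have hsmall : ∀ x ∈ Ioo 0 c, x < e → 0 < L x := by
    have hneg : ∀ x ∈ Ioo 0 c, x < e → ¬ L x < 0 := by
      intro x hx hxe hLx
      obtain ⟨a, ha1, ha2⟩ := ((hl.eventually (lt_mem_nhds hLx)).and (Ioo_mem_nhdsGT hx.1)).exists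
      obtain ⟨m, hm, hmin⟩ := isCompact_Icc.exists_isMinOn (nonempty_Icc.2 ha2.2.le)
        (fun y hy => (hd y ⟨ha2.1.trans_le hy.1,
          hy.2.trans_lt hx.2⟩).continuousAt.continuousWithinAt)
      have h3 : L m ≤ L x := hmin (right_mem_Icc.2 ha2.2.le)
      have h4 : a < m := by
        refine lt_of_le_of_ne hm.1 fun h => ?_
        rw [← h] at h3; linarith
      have hm' : m ∈ Ioo 0 c := ⟨ha2.1.trans h4, hm.2.trans_lt hx.2⟩
      have h5 := ((hd m hm').sub_const (L m)).eventually_neg_left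
        (h1 m hm' (hm.2.trans_lt hxe) (by linarith)) (by simp)
      obtain ⟨y, hy1, hy2⟩ := (h5.and (Ioo_mem_nhdsLT h4)).exists
      have h6 : L m ≤ L y := hmin ⟨hy2.1.le, hy2.2.le.trans hm.2⟩
      linarith
    intro x hx hxe
    refine lt_of_le_of_ne (not_lt.1 (hneg x hx hxe)) fun h => ?_
    obtain ⟨y, hy1, hy2⟩ := (((hd x hx).eventually_neg_left (h0 x hx h.symm) h.symm.le).and
      (Ioo_mem_nhdsLT hx.1)).exists
    exact hneg y ⟨hy2.1, hy2.2.trans hx.2⟩ (hy2.2.trans hxe) hy1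
  intro x hx
  obtain ⟨a, ha, hae⟩ : ∃ a, a ∈ Ioo 0 x ∧ a < e :=
    ⟨min x e / 2, ⟨by have := lt_min hx.1 he; linarith,
      by have := lt_min hx.1 he; linarith [min_le_left x e]⟩,
      by have := lt_min hx.1 he; linarith [min_le_right x e]⟩
  refine pos_of_no_first_zero_Ico (a := a) (b := c) (hsmall a ⟨ha.1, ha.2.trans hx.2⟩ hae)
    (fun y hy => (hd y ⟨ha.1.trans_le hy.1, hy.2⟩).continuousAt) (fun y hy hy0 hl => ?_) x
    ⟨ha.2.le, hx.2⟩
  have hy' : y ∈ Ioo 0 c := ⟨ha.1.trans hy.1, hy.2⟩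
  exact not_pos_left_of_hasDerivAt_pos hy.1 (hd y hy') (h0 y hy' hy0) hy0.le
    fun z hz => hl z ⟨hz.1.le, hz.2⟩

/-- The logarithmic derivative of `s ^ (p - 1) - 1` with respect to `log s`. -/
noncomputable def powRate (p s : ℝ) : ℝ := (p - 1) * s ^ (p - 1) / (s ^ (p - 1) - 1)

theorem powRate_lt {p s t : ℝ} (hp : 1 < p) (hs : 1 < s) (hst : s < t) :
    powRate p t < powRate p s := by
  have h1 : 1 < s ^ (p - 1) := one_lt_rpow hs (by linarith)
  have h2 : s ^ (p - 1) < t ^ (p - 1) := rpow_lt_rpow (by linarith) hst (by linarith)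
  rw [powRate, powRate, div_lt_div_iff₀ (by linarith) (by linarith)]
  nlinarith

theorem Sol.hasDerivAt_log_potential {d p : ℝ} {u u' : ℝ → ℝ} (h : Sol d p u u') (hp : 1 < p)
    {r : ℝ} (hr : 0 < r) (hu : 1 < u r) :
    HasDerivAt (fun r => log (r ^ 2 * (u r ^ (p - 1) - 1)))
      ((2 - logSlope u u' r * powRate p (u r)) / r) r := by
  have h1 : 0 < u r ^ (p - 1) - 1 := sub_pos.2 (one_lt_rpow hu (by linarith))
  have hu0 : 0 < u r := by linarith
  have h2 := ((hasDerivAt_pow 2 r).mul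
    (((h.deriv1 r hr).rpow_const (p := p - 1) (Or.inl hu0.ne')).sub_const 1)).log
    (mul_pos (by positivity) h1).ne'
  refine h2.congr_deriv ?_
  rw [rpow_sub_one hu0.ne' (p - 1), powRate, logSlope]
  simp only [Pi.mul_apply]
  have := h1.ne'
  field_simp
  push_cast
  ring

namespace Ground

variable {d p α : ℝ} {g g' : ℝ → ℝ}

theorem hasDerivAt_logSlope (hg : Ground d p α g g') {r : ℝ} (hr : 0 < r) :
    HasDerivAt (logSlope g g') (slopeRate d p g g' r / r) r :=
  hg.sol.hasDerivAt_logSlope hr (hg.pos r hr)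

theorem logSlope_pos (hg : Ground d p α g g') {r : ℝ} (hr : 0 < r) : 0 < logSlope g g' r := by
  rw [logSlope, neg_pos]
  exact div_neg_of_neg_of_pos (mul_neg_of_pos_of_neg hr (hg.deriv_neg r hr)) (hg.pos r hr)

theorem logSlope_strictMonoOn (hg : Ground d p α g g') : StrictMonoOn (logSlope g g') (Ioi 0) :=
  fun a ha b _ hab => by
    have ha0 : 0 < a := ha
    exact lt_of_hasDerivAt_pos hab
      (fun x hx => (hg.hasDerivAt_logSlope (ha0.trans_le hx.1)).continuousAt.continuousWithinAt)
      (fun x hx => hg.hasDerivAt_logSlope (ha0.trans hx.1))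
      fun x hx => div_pos (hg.slopeRate_pos x (ha0.trans hx.1)) (ha0.trans hx.1)

theorem strictAntiOn (hg : Ground d p α g g') : StrictAntiOn g (Ioi 0) :=
  fun a ha b _ hab => by
    have ha0 : 0 < a := ha
    have := lt_of_hasDerivAt_pos (h := fun r => -g r) (h' := fun r => -g' r) hab
      (hg.sol.continuousOn ha0).neg (fun x hx => (hg.sol.deriv1 x (ha0.trans hx.1)).neg)
      fun x hx => by linarith [hg.deriv_neg x (ha0.trans hx.1)]
    linarith

theorem lt_init (hg : Ground d p α g g') {r : ℝ} (hr : 0 < r) : g r < α := by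
  have h1 : g (r / 2) ≤ α := by
    refine ge_of_tendsto hg.tendsto_zero ?_
    filter_upwards [Ioo_mem_nhdsGT (show 0 < r / 2 by positivity)] with x hx
    exact (hg.strictAntiOn hx.1 (show 0 < r / 2 by positivity) hx.2).le
  exact (hg.strictAntiOn (show 0 < r / 2 by positivity) hr (by linarith)).trans_le h1

theorem exists_eq (hg : Ground d p α g g') {s : ℝ} (hs0 : 0 < s) (hs : s < α) :
    ∃ t, 0 < t ∧ g t = s := by
  obtain ⟨a, ha1, ha2⟩ := ((hg.tendsto_zero.eventually (lt_mem_nhds hs)).and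
    self_mem_nhdsWithin).exists
  obtain ⟨b, hb1, hb2⟩ := ((hg.tendsto_atTop.eventually (gt_mem_nhds hs0)).and
    (eventually_ge_atTop a)).exists
  have ha0 : 0 < a := ha2
  obtain ⟨t, ht, hts⟩ := intermediate_value_Icc' hb2 (hg.sol.continuousOn ha0)
    ⟨hb1.le, ha1.le⟩
  exact ⟨t, ha0.trans_le ht.1, hts⟩

end Ground

theorem tendsto_logSlope_zero {α c : ℝ} {u u' : ℝ → ℝ} (hα : 0 < α)
    (h0 : Tendsto u (nhdsWithin 0 (Ioi 0)) (nhds α))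
    (h1 : Tendsto (fun r => u' r / r) (nhdsWithin 0 (Ioi 0)) (nhds c)) :
    Tendsto (logSlope u u') (nhdsWithin 0 (Ioi 0)) (nhds 0) := by
  have hr0 : Tendsto (fun r : ℝ => r) (nhdsWithin 0 (Ioi 0)) (nhds 0) :=
    tendsto_id.mono_left nhdsWithin_le_nhds
  have h2 := (((hr0.pow 2).mul h1).div h0 hα.ne').neg
  simp only [ne_eq, OfNat.ofNat_ne_zero, not_false_eq_true, zero_pow, zero_mul, zero_div,
    neg_zero] at h2
  refine h2.congr' ?_
  filter_upwards [self_mem_nhdsWithin] with r hr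
  have : r ≠ 0 := (show 0 < r from hr).ne'
  simp only [logSlope, Pi.div_apply]
  congr 2
  field_simp

theorem f_pos {p s : ℝ} (hp : 1 < p) (hs : 1 < s) : 0 < f p s := by
  rw [f_of_pos (by linarith)]
  have := one_lt_rpow hs (show 0 < p - 1 by linarith)
  exact mul_pos (by linarith) (by linarith)

/-- `r² (u^(p-1) - 1)` and `(d+1)` times the logarithmic slope agree to leading order at `0`. -/
theorem tendsto_potential_div_logSlope {d p α : ℝ} {u u' : ℝ → ℝ} (hp : 1 < p) (hd : 0 ≤ d)
    (hα : 1 < α) (h0 : Tendsto u (nhdsWithin 0 (Ioi 0)) (nhds α))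
    (h1 : Tendsto (fun r => u' r / r) (nhdsWithin 0 (Ioi 0)) (nhds (-f p α / (d + 1)))) :
    Tendsto (fun r => r ^ 2 * (u r ^ (p - 1) - 1) / logSlope u u' r) (nhdsWithin 0 (Ioi 0))
      (nhds (d + 1)) := by
  have hf := f_pos hp hα
  have hlim : -f p α / (d + 1) ≠ 0 := (div_neg_of_neg_of_pos (by linarith) (by linarith)).ne
  have h2 := ((((continuous_f hp).tendsto α).comp h0).neg).div h1 hlim
  have h3 : -f p α / (-f p α / (d + 1)) = d + 1 := by
    have : d + 1 ≠ 0 := by linarith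
    field_simp
  rw [h3] at h2
  refine h2.congr' ?_
  filter_upwards [self_mem_nhdsWithin, h0.eventually (lt_mem_nhds hα),
    h1.eventually_ne hlim] with r hr hur hne
  have hr0 : r ≠ 0 := (show 0 < r from hr).ne'
  have hu0 : 0 < u r := by linarith
  have hu' : u' r ≠ 0 := fun h => hne (by simp [h])
  simp only [Pi.div_apply, Function.comp_apply, logSlope]
  rw [f_of_pos hu0]
  field_simp

/-- A reparametrization `ρ` of the ground state that matches the logarithmic slope of `u` on
`(0, b)`, inside the region where the ground state exceeds `1`. -/
structure Matching (d p α₀ α : ℝ) (g g' u u' : ℝ → ℝ) (t₁ b : ℝ) (ρ : ℝ → ℝ) : Prop where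
  ground : Ground d p α₀ g g'
  sol : Sol d p u u'
  one_lt_p : 1 < p
  d_nonneg : 0 ≤ d
  lt_init : α₀ < α
  tendsto_zero : Tendsto u (nhdsWithin 0 (Ioi 0)) (nhds α)
  tendsto_deriv_div : Tendsto (fun r => u' r / r) (nhdsWithin 0 (Ioi 0)) (nhds (-f p α / (d + 1)))
  eq_one : g t₁ = 1
  b_pos : 0 < b
  pos : ∀ r ∈ Ioo 0 b, 0 < u r
  mem : ∀ r ∈ Ioo 0 b, ρ r ∈ Ioo 0 t₁
  logSlope_eq : ∀ r ∈ Ioo 0 b, logSlope g g' (ρ r) = logSlope u u' r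
  deriv : ∀ r ∈ Ioo 0 b, HasDerivAt ρ
    ((slopeRate d p g g' (ρ r) / ρ r)⁻¹ * (slopeRate d p u u' r / r)) r

namespace Matching

variable {d p α₀ α t₁ b : ℝ} {g g' u u' ρ : ℝ → ℝ}

theorem one_lt (h : Matching d p α₀ α g g' u u' t₁ b ρ) {r : ℝ} (hr : r ∈ Ioo 0 b) :
    1 < g (ρ r) := by
  have h1 := h.mem r hr
  rw [← h.eq_one]
  exact h.ground.strictAntiOn h1.1 (h1.1.trans h1.2) h1.2

theorem logSlope_pos (h : Matching d p α₀ α g g' u u' t₁ b ρ) {r : ℝ} (hr : r ∈ Ioo 0 b) :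
    0 < logSlope u u' r := by
  rw [← h.logSlope_eq r hr]
  exact h.ground.logSlope_pos (h.mem r hr).1

theorem tendsto_match (h : Matching d p α₀ α g g' u u' t₁ b ρ) :
    Tendsto ρ (nhdsWithin 0 (Ioi 0)) (nhdsWithin 0 (Ioi 0)) := by
  have hmem : ∀ᶠ r in nhdsWithin (0 : ℝ) (Ioi 0), r ∈ Ioo 0 b := Ioo_mem_nhdsGT h.b_pos
  refine tendsto_nhdsWithin_iff.2 ⟨?_, hmem.mono fun r hr => (h.mem r hr).1⟩
  rw [tendsto_order]
  refine ⟨fun a ha => hmem.mono fun r hr => ha.trans (h.mem r hr).1, fun a ha => ?_⟩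
  have hα : 0 < α := by linarith [h.ground.one_lt, h.lt_init]
  filter_upwards [hmem, (tendsto_logSlope_zero hα h.tendsto_zero h.tendsto_deriv_div).eventually
    (gt_mem_nhds (h.ground.logSlope_pos ha))] with r hr hr1
  rw [← h.logSlope_eq r hr] at hr1
  exact (h.ground.logSlope_strictMonoOn.lt_iff_lt (h.mem r hr).1 ha).1 hr1

theorem slopeRate_sub (h : Matching d p α₀ α g g' u u' t₁ b ρ) {r : ℝ} (hr : r ∈ Ioo 0 b) :
    slopeRate d p u u' r - slopeRate d p g g' (ρ r)
      = r ^ 2 * (u r ^ (p - 1) - 1) - ρ r ^ 2 * (g (ρ r) ^ (p - 1) - 1) := by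
  rw [slopeRate, slopeRate, h.logSlope_eq r hr]; ring

theorem hasDerivAt_gap (h : Matching d p α₀ α g g' u u' t₁ b ρ) {r : ℝ} (hr : r ∈ Ioo 0 b) :
    HasDerivAt (fun r => log (u r) - log (g (ρ r)))
      (logSlope u u' r / r * ((slopeRate d p u u' r - slopeRate d p g g' (ρ r))
        / slopeRate d p g g' (ρ r))) r := by
  have hr0 := hr.1
  have hρ := (h.mem r hr).1
  have hu := h.pos r hr
  have hg := h.ground.pos _ hρ
  have hN := h.ground.slopeRate_pos _ hρ
  have h1 := ((h.sol.deriv1 r hr0).log hu.ne').sub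
    (((h.ground.sol.deriv1 _ hρ).comp r (h.deriv r hr)).log hg.ne')
  refine h1.congr_deriv ?_
  have h2 : u' r = -(logSlope u u' r * u r / r) := by
    rw [logSlope]; field_simp
  have h3 : g' (ρ r) = -(logSlope u u' r * g (ρ r) / ρ r) := by
    rw [← h.logSlope_eq r hr, logSlope]; field_simp
  simp only [Function.comp_apply]
  rw [h2, h3]
  generalize slopeRate d p g g' (ρ r) = N at *
  generalize slopeRate d p u u' r = N' at *
  generalize logSlope u u' r = θ at *
  field_simp
  ring

theorem hasDerivAt_log_ratio (h : Matching d p α₀ α g g' u u' t₁ b ρ) {r : ℝ} (hr : r ∈ Ioo 0 b)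
    (hu : 1 < u r) :
    HasDerivAt (fun r => log (r ^ 2 * (u r ^ (p - 1) - 1))
        - log (ρ r ^ 2 * (g (ρ r) ^ (p - 1) - 1)))
      (((2 - logSlope u u' r * powRate p (u r)) * slopeRate d p g g' (ρ r)
        - (2 - logSlope u u' r * powRate p (g (ρ r))) * slopeRate d p u u' r)
        / (slopeRate d p g g' (ρ r) * r)) r := by
  have hr0 := hr.1
  have hρ := (h.mem r hr).1
  have hN := h.ground.slopeRate_pos _ hρ
  have h1 := (h.sol.hasDerivAt_log_potential h.one_lt_p hr0 hu).sub
    ((h.ground.sol.hasDerivAt_log_potential h.one_lt_p hρ (h.one_lt hr)).comp r (h.deriv r hr))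
  refine h1.congr_deriv ?_
  rw [h.logSlope_eq r hr]
  generalize slopeRate d p g g' (ρ r) = N at *
  generalize slopeRate d p u u' r = N' at *
  generalize logSlope u u' r = θ at *
  field_simp

theorem tendsto_log_ratio (h : Matching d p α₀ α g g' u u' t₁ b ρ) :
    Tendsto (fun r => log (r ^ 2 * (u r ^ (p - 1) - 1))
        - log (ρ r ^ 2 * (g (ρ r) ^ (p - 1) - 1))) (nhdsWithin 0 (Ioi 0)) (nhds 0) := by
  have hα := h.ground.one_lt
  have hα' : 1 < α := hα.trans h.lt_init
  have hd : d + 1 ≠ 0 := by linarith [h.d_nonneg]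
  have h1 := tendsto_potential_div_logSlope h.one_lt_p h.d_nonneg hα' h.tendsto_zero
    h.tendsto_deriv_div
  have h2 := (tendsto_potential_div_logSlope h.one_lt_p h.d_nonneg hα h.ground.tendsto_zero
    h.ground.tendsto_deriv_div).comp h.tendsto_match
  have h3 := (h1.log hd).sub (h2.log hd)
  rw [sub_self] at h3
  refine h3.congr' ?_
  filter_upwards [Ioo_mem_nhdsGT h.b_pos, h.tendsto_zero.eventually (lt_mem_nhds hα')] with r hr hu
  have hr0 : r ≠ 0 := hr.1.ne'
  have hρ0 : ρ r ≠ 0 := (h.mem r hr).1.ne'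
  have hp := h.one_lt_p
  have h4 : u r ^ (p - 1) - 1 ≠ 0 := (sub_pos.2 (one_lt_rpow hu (by linarith))).ne'
  have h5 : g (ρ r) ^ (p - 1) - 1 ≠ 0 := (sub_pos.2 (one_lt_rpow (h.one_lt hr) (by linarith))).ne'
  have h6 := (h.logSlope_pos hr).ne'
  simp only [Function.comp_apply]
  rw [h.logSlope_eq r hr, log_div (by positivity) h6, log_div (by positivity) h6]
  ring

/-- As long as `u` stays above the matched ground state, so does the potential term. -/
theorem potential_lt (h : Matching d p α₀ α g g' u u' t₁ b ρ) {c : ℝ} (hcb : c ≤ b)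
    (hgap : ∀ r ∈ Ioo 0 c, g (ρ r) < u r) :
    ∀ r ∈ Ioo 0 c, ρ r ^ 2 * (g (ρ r) ^ (p - 1) - 1) < r ^ 2 * (u r ^ (p - 1) - 1) := by
  have hp := h.one_lt_p
  have hmem : ∀ r ∈ Ioo 0 c, r ∈ Ioo 0 b := fun r hr => ⟨hr.1, hr.2.trans_le hcb⟩
  have hu1 : ∀ r ∈ Ioo 0 c, 1 < u r := fun r hr => (h.one_lt (hmem r hr)).trans (hgap r hr)
  have hTu : ∀ r ∈ Ioo 0 c, 0 < r ^ 2 * (u r ^ (p - 1) - 1) := fun r hr => by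
    have h1 := sub_pos.2 (one_lt_rpow (hu1 r hr) (show 0 < p - 1 by linarith))
    have := hr.1
    positivity
  have hTg : ∀ r ∈ Ioo 0 c, 0 < ρ r ^ 2 * (g (ρ r) ^ (p - 1) - 1) := fun r hr => by
    have h1 := sub_pos.2 (one_lt_rpow (h.one_lt (hmem r hr)) (show 0 < p - 1 by linarith))
    have := (h.mem r (hmem r hr)).1
    positivity
  obtain ⟨e, he, hsmall⟩ : ∃ e, 0 < e ∧ ∀ r ∈ Ioo 0 c, r < e →
      0 ≤ 2 - logSlope u u' r * powRate p (g (ρ r)) := by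
    have hα := h.ground.one_lt
    have hα1 := one_lt_rpow hα (show 0 < p - 1 by linarith)
    have h1 := h.ground.tendsto_zero.rpow_const (p := p - 1) (Or.inl (by linarith : α₀ ≠ 0))
    have h2 := (h1.const_mul (p - 1)).div (h1.sub_const 1) (sub_pos.2 hα1).ne'
    have h3 := (tendsto_logSlope_zero (by linarith) h.ground.tendsto_zero
      h.ground.tendsto_deriv_div).mul h2
    rw [zero_mul] at h3
    obtain ⟨e, he, he'⟩ := mem_nhdsGT_iff_exists_Ioo_subset.1
      ((h3.comp h.tendsto_match).eventually (gt_mem_nhds two_pos))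
    refine ⟨e, he, fun r hr hre => ?_⟩
    have h4 := he' ⟨hr.1, hre⟩
    have h5 : logSlope g g' (ρ r) * powRate p (g (ρ r)) < 2 := h4
    rw [h.logSlope_eq r (hmem r hr)] at h5
    linarith
  have hpos : ∀ r ∈ Ioo 0 c, (2 - logSlope u u' r * powRate p (g (ρ r))) * slopeRate d p u u' r
      ≤ (2 - logSlope u u' r * powRate p (g (ρ r))) * slopeRate d p g g' (ρ r) →
      0 < ((2 - logSlope u u' r * powRate p (u r)) * slopeRate d p g g' (ρ r)
        - (2 - logSlope u u' r * powRate p (g (ρ r))) * slopeRate d p u u' r)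
        / (slopeRate d p g g' (ρ r) * r) := by
    intro r hr hle
    have hN := h.ground.slopeRate_pos _ (h.mem r (hmem r hr)).1
    refine div_pos ?_ (mul_pos hN hr.1)
    have h1 := mul_lt_mul_of_pos_left (powRate_lt hp (h.one_lt (hmem r hr)) (hgap r hr))
      (h.logSlope_pos (hmem r hr))
    have h2 := mul_lt_mul_of_pos_right h1 hN
    linarith
  have key := pos_of_tendsto_zero he
    (fun r hr => h.hasDerivAt_log_ratio (hmem r hr) (hu1 r hr)) (fun r hr h0 => hpos r hr ?_)
    (fun r hr hre h0 => hpos r hr ?_) h.tendsto_log_ratio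
  · intro r hr
    have := key r hr
    rw [sub_pos] at this
    exact (log_lt_log_iff (hTg r hr) (hTu r hr)).1 this
  · have h1 := log_injOn_pos (hTu r hr) (hTg r hr) (sub_eq_zero.1 h0)
    have h2 := h.slopeRate_sub (hmem r hr)
    have h3 : slopeRate d p u u' r = slopeRate d p g g' (ρ r) := by linarith
    rw [h3]
  · have h1 := (log_le_log_iff (hTu r hr) (hTg r hr)).1 (sub_nonpos.1 h0)
    have h2 := h.slopeRate_sub (hmem r hr)
    exact mul_le_mul_of_nonneg_left (by linarith) (hsmall r hr hre)

/-- `u` stays uniformly above the matched ground state. -/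
theorem exists_gap (h : Matching d p α₀ α g g' u u' t₁ b ρ) :
    ∃ c, 1 < c ∧ ∀ r ∈ Ioo 0 b, c * g (ρ r) ≤ u r := by
  have hα := h.ground.one_lt
  have hlim : Tendsto (fun r => log (u r) - log (g (ρ r))) (nhdsWithin 0 (Ioi 0))
      (nhds (log α - log α₀)) :=
    (h.tendsto_zero.log (by linarith [h.lt_init])).sub
      ((h.ground.tendsto_zero.comp h.tendsto_match).log (by linarith))
  have hκ : 0 < log α - log α₀ := sub_pos.2 (log_lt_log (by linarith) h.lt_init)
  obtain ⟨κ, hκ0, hκ1⟩ := exists_between hκ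
  obtain ⟨e, he, he'⟩ := mem_nhdsGT_iff_exists_Ioo_subset.1
    (hlim.eventually (lt_mem_nhds hκ1))
  have he0 : 0 < e := he
  have hsmall : ∀ r, 0 < r → r < e → κ < log (u r) - log (g (ρ r)) := fun r h1 h2 => he' ⟨h1, h2⟩
  have hgap_iff : ∀ r ∈ Ioo 0 b, 0 < log (u r) - log (g (ρ r)) → g (ρ r) < u r := fun r hr h1 =>
    (log_lt_log_iff (h.ground.pos _ (h.mem r hr).1) (h.pos r hr)).1 (sub_pos.1 h1)
  obtain ⟨a, ha0, hae, hab⟩ : ∃ a, 0 < a ∧ a < e ∧ a < b :=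
    ⟨min e b / 2, by have := lt_min he0 h.b_pos; linarith,
      by have := lt_min he0 h.b_pos; linarith [min_le_left e b],
      by have := lt_min he0 h.b_pos; linarith [min_le_right e b]⟩
  have hmono : ∀ x ∈ Ico a b, (∀ r ∈ Ico a x, 0 < log (u r) - log (g (ρ r))) →
      log (u a) - log (g (ρ a)) ≤ log (u x) - log (g (ρ x)) := by
    intro x hx hl
    have hmem : ∀ r ∈ Icc a x, r ∈ Ioo 0 b := fun r hr => ⟨by linarith [hr.1], by linarith [hr.2, hx.2]⟩
    have hT := h.potential_lt hx.2.le fun r hr => by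
      rcases lt_or_ge r a with hra | hra
      · exact hgap_iff r ⟨hr.1, by linarith⟩ (hκ0.trans (hsmall r hr.1 (by linarith)))
      · exact hgap_iff r ⟨hr.1, by linarith [hr.2, hx.2]⟩ (hl r ⟨hra, hr.2⟩)
    refine le_of_hasDerivAt_nonneg (h := fun r => log (u r) - log (g (ρ r))) hx.1
      (fun r hr => (h.hasDerivAt_gap (hmem r hr)).continuousAt.continuousWithinAt)
      (fun r hr => h.hasDerivAt_gap (hmem r ⟨hr.1.le, hr.2.le⟩)) fun r hr => ?_
    have hr' := hmem r ⟨hr.1.le, hr.2.le⟩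
    have h1 := hT r ⟨hr'.1, hr.2⟩
    have h2 := h.slopeRate_sub hr'
    exact mul_nonneg (div_nonneg (h.logSlope_pos hr').le hr'.1.le)
      (div_nonneg (by linarith) (h.ground.slopeRate_pos _ (h.mem r hr').1).le)
  have hpos := pos_of_no_first_zero_Ico (φ := fun r => log (u r) - log (g (ρ r))) (a := a) (b := b)
    (hκ0.trans (hsmall a ha0 hae))
    (fun x hx => (h.hasDerivAt_gap ⟨by linarith [hx.1], hx.2⟩).continuousAt)
    fun x hx hx0 hl => by
      have h1 := hmono x ⟨hx.1.le, hx.2⟩ hl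
      have h2 := hsmall a ha0 hae
      linarith
  refine ⟨exp κ, one_lt_exp_iff.2 hκ0, fun r hr => ?_⟩
  have h1 : κ ≤ log (u r) - log (g (ρ r)) := by
    rcases lt_or_ge r a with hra | hra
    · exact (hsmall r hr.1 (by linarith)).le
    · exact (hsmall a ha0 hae).le.trans
        (hmono r ⟨hra, hr.2⟩ fun y hy => hpos y ⟨hy.1, hy.2.trans hr.2⟩)
  have h2 := h.ground.pos _ (h.mem r hr).1
  rw [← exp_log h2, ← exp_add, ← exp_log (h.pos r hr)]
  exact exp_le_exp.2 (by linarith)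

theorem slopeRate_pos (h : Matching d p α₀ α g g' u u' t₁ b ρ) {r : ℝ} (hr : r ∈ Ioo 0 b) :
    0 < slopeRate d p u u' r := by
  obtain ⟨c, hc, hgap⟩ := h.exists_gap
  have h1 := h.potential_lt le_rfl (fun x hx => by
    have h2 := h.ground.pos _ (h.mem x hx).1
    exact (lt_mul_of_one_lt_left h2 hc).trans_le (hgap x hx)) r hr
  have h2 := h.slopeRate_sub hr
  linarith [h.ground.slopeRate_pos _ (h.mem r hr).1]

end Matching

theorem exists_matching {d p α₀ α t₁ b : ℝ} {g g' u u' : ℝ → ℝ} (hg : Ground d p α₀ g g')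
    (hs : Sol d p u u') (hp : 1 < p) (hd : 0 ≤ d) (hα : α₀ < α)
    (h0 : Tendsto u (nhdsWithin 0 (Ioi 0)) (nhds α))
    (h1 : Tendsto (fun r => u' r / r) (nhdsWithin 0 (Ioi 0)) (nhds (-f p α / (d + 1))))
    (ht₁ : 0 < t₁) (hgt₁ : g t₁ = 1) (hb : 0 < b) (hpos : ∀ r ∈ Ioo 0 b, 0 < u r)
    (hslope : ∀ r ∈ Ioo 0 b, 0 < logSlope u u' r ∧ logSlope u u' r < logSlope g g' t₁) :
    ∃ ρ, Matching d p α₀ α g g' u u' t₁ b ρ := by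
  obtain ⟨ι, hι⟩ := exists_inverse_hasDerivAt (fun t ht => hg.hasDerivAt_logSlope ht)
    fun t ht => div_pos (hg.slopeRate_pos t ht) ht
  have hex : ∀ r ∈ Ioo 0 b, ι (logSlope u u' r) ∈ Ioo 0 t₁ ∧
      logSlope g g' (ι (logSlope u u' r)) = logSlope u u' r := by
    intro r hr
    obtain ⟨h2, h3⟩ := hslope r hr
    have hα₀ : 0 < α₀ := by linarith [hg.one_lt]
    obtain ⟨a, ha1, ha2⟩ := (((tendsto_logSlope_zero hα₀ hg.tendsto_zero
      hg.tendsto_deriv_div).eventually (gt_mem_nhds h2)).and (Ioo_mem_nhdsGT ht₁)).exists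
    obtain ⟨t, ht, htr⟩ := intermediate_value_Ioo ha2.2.le (fun x hx => (hg.hasDerivAt_logSlope
      (ha2.1.trans_le hx.1)).continuousAt.continuousWithinAt) ⟨ha1, h3⟩
    have ht0 : 0 < t := ha2.1.trans ht.1
    rw [← htr, (hι t ht0).1]
    exact ⟨⟨ht0, ht.2⟩, rfl⟩
  refine ⟨fun r => ι (logSlope u u' r), hg, hs, hp, hd, hα, h0, h1, hgt₁, hb, hpos,
    fun r hr => (hex r hr).1, fun r hr => (hex r hr).2, fun r hr => ?_⟩
  have h2 := (hι _ (hex r hr).1.1).2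
  rw [(hex r hr).2] at h2
  exact h2.comp r (hs.hasDerivAt_logSlope hr.1 (hpos r hr))

/-- Up to the first time `u` equals `1`, the logarithmic slope of `u` exceeds that of the ground
state at equal height. -/
theorem exists_logSlope_lt {d p α₀ α : ℝ} {g g' u u' : ℝ → ℝ} (hg : Ground d p α₀ g g')
    (hs : Sol d p u u') (hp : 1 < p) (hd : 1 ≤ d) (hα : α₀ < α)
    (h0 : Tendsto u (nhdsWithin 0 (Ioi 0)) (nhds α))
    (h1 : Tendsto (fun r => u' r / r) (nhdsWithin 0 (Ioi 0)) (nhds (-f p α / (d + 1))))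
    (hpos : ∀ r, 0 < r → 0 < u r) :
    ∃ R₁, 0 < R₁ ∧ u R₁ = 1 ∧ (∀ r ∈ Ioo 0 R₁, 1 < u r) ∧ ∀ r ∈ Ioc 0 R₁, u' r < 0 ∧
      ∀ σ, 0 < σ → g σ = u r → logSlope g g' σ < logSlope u u' r := by
  have hα₀ := hg.one_lt
  have hα1 : 1 < α := hα₀.trans hα
  have hd0 : 0 ≤ d := by linarith
  have hc : -f p α / (d + 1) < 0 :=
    div_neg_of_neg_of_pos (by linarith [f_pos hp hα1]) (by linarith)
  obtain ⟨t₁, ht₁, hgt₁⟩ := hg.exists_eq one_pos hα₀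
  have hΘ0 := hg.logSlope_pos ht₁
  have hΘ : d - 1 < logSlope g g' t₁ := by
    have h2 := hg.slopeRate_pos t₁ ht₁
    rw [slopeRate, hgt₁, one_rpow, sub_self, mul_zero, add_zero] at h2
    nlinarith
  have hlim := tendsto_logSlope_zero (by linarith) h0 h1
  obtain ⟨e, he, he'⟩ := mem_nhdsGT_iff_exists_Ioo_subset.1
    (((h0.eventually (lt_mem_nhds hα1)).and (h1.eventually (gt_mem_nhds hc))).and
      (hlim.eventually (gt_mem_nhds hΘ0)))
  have he0 : 0 < e := he
  have hue : ∀ r, 0 < r → r < e → 1 < u r := fun r h2 h3 => (he' ⟨h2, h3⟩).1.1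
  have hu'e : ∀ r, 0 < r → r < e → u' r < 0 := fun r h2 h3 => by
    have h4 : u' r / r < 0 := (he' ⟨h2, h3⟩).1.2
    by_contra! h5
    exact h4.not_ge (by positivity)
  have hθe : ∀ r, 0 < r → r < e → logSlope u u' r < logSlope g g' t₁ :=
    fun r h2 h3 => (he' ⟨h2, h3⟩).2
  have ha0 : 0 < e / 2 := by linarith
  have hae : e / 2 < e := by linarith
  generalize e / 2 = a at ha0 hae
  have hle : ∀ r, r ≤ a → r < e := fun r hr => hr.trans_lt hae
  obtain ⟨R₁, haR, huR, hgt⟩ : ∃ R₁, a < R₁ ∧ u R₁ = 1 ∧ ∀ r ∈ Ico a R₁, 0 < u r - 1 := by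
    by_contra! hno
    have h2 := pos_of_no_first_zero (φ := fun r => u r - 1) (a := a)
      (by linarith [hue a ha0 hae])
      (fun x hx => ((hs.deriv1 x (by linarith)).sub_const 1).continuousAt)
      fun x hx hx0 hl => by
        obtain ⟨r, hr, hr'⟩ := hno x hx (by linarith)
        linarith [hl r hr]
    obtain ⟨r, hr, hr1⟩ := hs.exists_eq_one hp one_pos (a := a) fun r hr => by linarith [h2 r hr]
    linarith [h2 r hr]
  have hR0 : 0 < R₁ := ha0.trans haR
  have hgt1 : ∀ r ∈ Ioo 0 R₁, 1 < u r := fun r hr => by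
    rcases le_or_gt r a with h2 | h2
    · exact hue r hr.1 (hle r h2)
    · linarith [hgt r ⟨h2.le, hr.2⟩]
  have hu' : ∀ r ∈ Ioo 0 R₁, u' r < 0 := fun r hr => by
    rcases le_or_gt r a with h2 | h2
    · exact hu'e r hr.1 (hle r h2)
    have := pos_of_no_first_zero_Ico (φ := fun r => -u' r) (a := a) (b := R₁)
      (by linarith [hu'e a ha0 hae])
      (fun x hx => (hs.deriv2 x (by linarith [hx.1])).neg.continuousAt)
      (fun x hx hx0 hl => by
        have hxp : 0 < x := by linarith [hx.1]
        have h3 : u' x = 0 := by linarith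
        refine not_pos_left_of_hasDerivAt_pos hx.1 (hs.deriv2 x hxp).neg ?_ hx0.le
          fun y hy => hl y ⟨hy.1.le, hy.2⟩
        rw [h3]
        linarith [f_pos hp (hgt1 x ⟨hxp, hx.2⟩)]) r ⟨h2.le, hr.2⟩
    linarith
  have hθpos : ∀ r ∈ Ioo 0 R₁, 0 < logSlope u u' r := fun r hr => by
    rw [logSlope, neg_pos]
    exact div_neg_of_neg_of_pos (mul_neg_of_pos_of_neg hr.1 (hu' r hr)) (hpos r hr.1)
  have hθd := fun r (hr : 0 < r) => hs.hasDerivAt_logSlope hr (hpos r hr)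
  obtain ⟨b, hab, hbR, hθb, hθlt⟩ : ∃ b, a < b ∧ b < R₁ ∧ logSlope u u' b = logSlope g g' t₁ ∧
      ∀ r ∈ Ico a b, 0 < logSlope g g' t₁ - logSlope u u' r := by
    by_contra! hno
    have h2 := pos_of_no_first_zero_Ico (φ := fun r => logSlope g g' t₁ - logSlope u u' r)
      (a := a) (b := R₁) (by linarith [hθe a ha0 hae])
      (fun x hx => ((hθd x (by linarith [hx.1])).const_sub _).continuousAt)
      fun x hx hx0 hl => by
        obtain ⟨r, hr, hr'⟩ := hno x hx.1 hx.2 (by linarith)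
        linarith [hl r hr]
    obtain ⟨ρ, hρ⟩ := exists_matching hg hs hp hd0 hα h0 h1 ht₁ hgt₁ hR0
      (fun r hr => hpos r hr.1) fun r hr => ⟨hθpos r hr, by
        rcases le_or_gt r a with h3 | h3
        · exact hθe r hr.1 (hle r h3)
        · linarith [h2 r ⟨h3.le, hr.2⟩]⟩
    obtain ⟨c, hc1, hgap⟩ := hρ.exists_gap
    have h3 : c ≤ u R₁ := by
      refine ge_of_tendsto ((hs.deriv1 R₁ hR0).continuousAt.tendsto.mono_left
        (nhdsWithin_le_nhds (s := Iio R₁))) ?_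
      filter_upwards [Ioo_mem_nhdsLT hR0] with r hr
      exact (le_mul_of_one_le_right (by linarith) (hρ.one_lt hr).le).trans (hgap r hr)
    linarith
  have hb0 : 0 < b := ha0.trans hab
  obtain ⟨ρ, hρ⟩ := exists_matching hg hs hp hd0 hα h0 h1 ht₁ hgt₁ hb0
    (fun r hr => hpos r hr.1) fun r hr => ⟨hθpos r ⟨hr.1, hr.2.trans hbR⟩, by
      rcases le_or_gt r a with h3 | h3
      · exact hθe r hr.1 (hle r h3)
      · linarith [hθlt r ⟨h3.le, hr.2⟩]⟩
  obtain ⟨c, hc1, hgap⟩ := hρ.exists_gap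
  obtain ⟨μ, hμ1, hμ2⟩ := exists_between (max_lt hΘ hΘ0)
  have hμd : d - 1 < μ := (le_max_left _ _).trans_lt hμ1
  have hμ0 : 0 < μ := (le_max_right _ _).trans_lt hμ1
  have hT : ∀ r ∈ Ioo 0 R₁, 0 < r ^ 2 * (u r ^ (p - 1) - 1) := fun r hr => by
    have h1 := sub_pos.2 (one_lt_rpow (hgt1 r hr) (show 0 < p - 1 by linarith))
    have := hr.1
    positivity
  have hafter : ∀ r ∈ Ico b R₁, 0 < logSlope u u' r - μ :=
    pos_of_no_first_zero_Ico (φ := fun r => logSlope u u' r - μ) (by linarith)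
      (fun x hx => ((hθd x (by linarith [hx.1])).sub_const _).continuousAt)
      fun x hx hx0 hl => by
        have hxp : 0 < x := by linarith [hx.1]
        refine not_pos_left_of_hasDerivAt_pos hx.1 ((hθd x hxp).sub_const μ) ?_ hx0.le
          fun y hy => hl y ⟨hy.1.le, hy.2⟩
        have h2 := mul_pos hμ0 (sub_pos.2 hμd)
        have h3 := hT x ⟨hxp, hx.2⟩
        refine div_pos ?_ hxp
        rw [slopeRate, show logSlope u u' x = μ by linarith]
        linarith
  have hinc : ∀ r, b < r → r ≤ R₁ → logSlope g g' t₁ < logSlope u u' r := fun r hbr hr => by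
    rw [← hθb]
    refine lt_of_hasDerivAt_pos hbr
      (fun x hx => (hθd x (by linarith [hx.1])).continuousAt.continuousWithinAt)
      (fun x hx => hθd x (by linarith [hx.1])) fun x hx => ?_
    have hxp : 0 < x := by linarith [hx.1]
    have h2 := hafter x ⟨hx.1.le, by linarith [hx.2]⟩
    have h3 := hT x ⟨hxp, by linarith [hx.2]⟩
    have h4 := mul_pos (show 0 < logSlope u u' x by linarith)
      (show 0 < logSlope u u' x - (d - 1) by linarith)
    refine div_pos ?_ hxp
    rw [slopeRate]
    linarith
  refine ⟨R₁, hR0, huR, hgt1, fun r hr => ⟨?_, fun σ hσ hgσ => ?_⟩⟩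
  · rcases hr.2.eq_or_lt with rfl | hlt
    · have h2 := hinc r hbR le_rfl
      by_contra! h3
      have h4 : logSlope u u' r ≤ 0 := by
        rw [logSlope, neg_nonpos]
        have := hr.1
        rw [huR]
        positivity
      linarith
    · exact hu' r ⟨hr.1, hlt⟩
  · have hu1 : 1 ≤ u r := by
      rcases hr.2.eq_or_lt with rfl | hlt
      · exact huR.ge
      · exact (hgt1 r ⟨hr.1, hlt⟩).le
    have hσt : σ ≤ t₁ := by
      rw [← hgσ, ← hgt₁] at hu1
      exact (hg.strictAntiOn.le_iff_ge ht₁ hσ).1 hu1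
    rcases lt_trichotomy r b with h2 | rfl | h2
    · have hrb : r ∈ Ioo 0 b := ⟨hr.1, h2⟩
      rw [← hρ.logSlope_eq r hrb]
      refine hg.logSlope_strictMonoOn hσ (hρ.mem r hrb).1 ?_
      refine (hg.strictAntiOn.lt_iff_gt (hρ.mem r hrb).1 hσ).1 ?_
      rw [hgσ]
      exact (lt_mul_of_one_lt_left (hg.pos _ (hρ.mem r hrb).1) hc1).trans_le (hgap r hrb)
    · rw [hθb]
      refine hg.logSlope_strictMonoOn hσ ht₁ (lt_of_le_of_ne hσt fun h => ?_)
      rw [h, hgt₁] at hgσ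
      linarith [hgt1 r ⟨hr.1, hbR⟩]
    · exact (hg.logSlope_strictMonoOn.monotoneOn hσ ht₁ hσt).trans_lt (hinc r h2 hr.2)

/-- A reparametrization `σ` of a ground state that matches the height of `u`. -/
theorem exists_heightMatching {d p α₀ : ℝ} {g g' u u' : ℝ → ℝ} (hg : Ground d p α₀ g g')
    (hs : Sol d p u u') (hpos : ∀ r, 0 < r → 0 < u r) :
    ∃ σ : ℝ → ℝ, ∀ r, 0 < r → u r < α₀ →
      0 < σ r ∧ g (σ r) = u r ∧ HasDerivAt σ (u' r / g' (σ r)) r := by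
  obtain ⟨ι, hι⟩ := exists_inverse_hasDerivAt (fun t ht => (hg.sol.deriv1 t ht).neg)
    fun t ht => neg_pos.2 (hg.deriv_neg t ht)
  refine ⟨fun r => ι (-u r), fun r hr hur => ?_⟩
  obtain ⟨t, ht, hgt⟩ := hg.exists_eq (hpos r hr) hur
  obtain ⟨h1, h2⟩ := hι t ht
  have h1' : ι (-u r) = t := by rw [← hgt]; exact h1
  have h2' : HasDerivAt ι (-g' t)⁻¹ (-u r) := by rw [← hgt]; exact h2
  change 0 < ι (-u r) ∧ g (ι (-u r)) = u r ∧
    HasDerivAt (fun r => ι (-u r)) (u' r / g' (ι (-u r))) r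
  rw [h1']
  refine ⟨ht, hgt, (h2'.comp r (hs.deriv1 r hr).neg).congr_deriv ?_⟩
  have := (hg.deriv_neg t ht).ne
  field_simp

section HeightMatching

variable {d p α₀ α : ℝ} {g g' u u' σ : ℝ → ℝ}

/-- Below height `1`, a slope ratio above `K` persists as long as `u` is steeper than the
ground state at equal height. -/
theorem mul_logSlope_lt_of_steeper (hg : Ground d p α₀ g g') (hs : Sol d p u u') (hp : 1 < p)
    (hd : 1 ≤ d) (hpos : ∀ r, 0 < r → 0 < u r)
    (hσ : ∀ r, 0 < r → u r < α₀ → 0 < σ r ∧ g (σ r) = u r ∧ HasDerivAt σ (u' r / g' (σ r)) r)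
    {R x K : ℝ} (hR : 0 < R) (huR : u R = 1) (hK : 1 < K)
    (hP : ∀ r ∈ Ico R x, u r < α₀ ∧ u' r < g' (σ r))
    (hKR : K * logSlope g g' (σ R) < logSlope u u' R) :
    ∀ r ∈ Ico R x, K * logSlope g g' (σ r) < logSlope u u' r := by
  have hD : ∀ r ∈ Ico R x, HasDerivAt (fun r => logSlope u u' r - K * logSlope g g' (σ r))
      (slopeRate d p u u' r / r
        - K * (slopeRate d p g g' (σ r) / σ r * (u' r / g' (σ r)))) r := by
    intro r hr
    have hr0 : 0 < r := hR.trans_le hr.1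
    obtain ⟨h1, h2, h3⟩ := hσ r hr0 (hP r hr).1
    exact (hs.hasDerivAt_logSlope hr0 (hpos r hr0)).sub
      (((hg.hasDerivAt_logSlope h1).comp r h3).const_mul K)
  have key := pos_of_no_first_zero_Ico
    (φ := fun r => logSlope u u' r - K * logSlope g g' (σ r)) (a := R) (b := x)
    (by linarith) (fun r hr => (hD r hr).continuousAt) (fun r hr hr0 hl => by
      have hr' : r ∈ Ico R x := ⟨hr.1.le, hr.2⟩
      refine not_pos_left_of_hasDerivAt_pos hr.1 (hD r hr') ?_ hr0.le
        fun y hy => hl y ⟨hy.1.le, hy.2⟩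
      have hrp : 0 < r := hR.trans hr.1
      obtain ⟨h1, h2, h3⟩ := hσ r hrp (hP r hr').1
      have hgn := hg.deriv_neg _ h1
      have hst := (hP r hr').2
      have hup := hpos r hrp
      have hθ := hg.logSlope_pos h1
      have hθe : logSlope u u' r = K * logSlope g g' (σ r) := by linarith
      have hu1 : u r < 1 := by
        rw [← huR]
        have := lt_of_hasDerivAt_pos (h := fun r => -u r) (h' := fun r => -u' r) hr.1
          (hs.continuousOn hR).neg (fun y hy => (hs.deriv1 y (hR.trans hy.1)).neg) fun y hy => by
            have hy' : y ∈ Ico R x := ⟨hy.1.le, hy.2.trans hr.2⟩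
            have h4 := hg.deriv_neg _ (hσ y (hR.trans hy.1) (hP y hy').1).1
            linarith [(hP y hy').2]
        linarith
      have hy1 : u r ^ (p - 1) < 1 := rpow_lt_one hup.le hu1 (by linarith)
      have hu'r : u' r = K * (σ r / r) * g' (σ r) := by
        have h5 := hθe
        rw [logSlope, logSlope, h2] at h5
        field_simp at h5 ⊢
        linarith
      have hq : u' r / g' (σ r) = K * (σ r / r) := by
        rw [hu'r, mul_div_assoc, div_self hgn.ne, mul_one]
      have hKσ : r < K * σ r := by
        rw [hu'r] at hst
        have h6 : 1 < K * (σ r / r) := by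
          by_contra! h7
          have := mul_le_mul_of_nonpos_right h7 hgn.le
          linarith
        rw [← mul_div_assoc, lt_div_iff₀ hrp] at h6
        linarith
      rw [hq]
      have h8 : slopeRate d p u u' r / r - K * (slopeRate d p g g' (σ r) / σ r * (K * (σ r / r)))
          = ((d - 1) * (K ^ 2 - K) * logSlope g g' (σ r)
            + (1 - u r ^ (p - 1)) * ((K * σ r) ^ 2 - r ^ 2)) / r := by
        rw [slopeRate, slopeRate, hθe, h2]
        field_simp
        ring
      rw [h8]
      have h9 : 0 ≤ (d - 1) * (K ^ 2 - K) * logSlope g g' (σ r) :=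
        mul_nonneg (mul_nonneg (by linarith) (by nlinarith)) hθ.le
      have h10 : 0 < (K * σ r) ^ 2 - r ^ 2 := by nlinarith
      have h11 := mul_pos (sub_pos.2 hy1) h10
      exact div_pos (by linarith) hrp)
  intro r hr
  linarith [key r hr]

/-- Once `u` is steeper than the ground state at equal height, it remains so, provided it has a
larger logarithmic slope. -/
theorem steeper_of_logSlope_lt (hg : Ground d p α₀ g g') (hs : Sol d p u u') (hd : 0 < d)
    (hpos : ∀ r, 0 < r → 0 < u r)
    (hσ : ∀ r, 0 < r → u r < α₀ → 0 < σ r ∧ g (σ r) = u r ∧ HasDerivAt σ (u' r / g' (σ r)) r)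
    {a : ℝ} (ha : 0 < a) (hua : u a < α₀) (hsa : u' a < g' (σ a))
    (hslope : ∀ x, a < x → u x < α₀ → (∀ r ∈ Ico a x, u r < α₀ ∧ u' r < g' (σ r)) →
      logSlope g g' (σ x) < logSlope u u' x) :
    ∀ r, a ≤ r → u r < α₀ ∧ u' r < g' (σ r) := by
  refine continuous_induction fun x hax hx => ?_
  have hx0 : 0 < x := ha.trans_le hax
  have hux : u x < α₀ := by
    have := le_of_hasDerivAt_nonneg (h := fun r => -u r) (h' := fun r => -u' r) hax
      (hs.continuousOn ha).neg (fun y hy => (hs.deriv1 y (ha.trans hy.1)).neg) fun y hy => by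
        have h1 := hx y ⟨hy.1.le, hy.2⟩
        have h4 := hg.deriv_neg _ (hσ y (ha.trans hy.1) h1.1).1
        linarith [h1.2]
    linarith
  obtain ⟨h1, h2, h3⟩ := hσ x hx0 hux
  have hD := ((hg.sol.deriv2 _ h1).comp x h3).sub (hs.deriv2 x hx0)
  have hcont : ContinuousAt (fun r => g' (σ r) - u' r) x := hD.continuousAt
  have hlt : 0 < g' (σ x) - u' x := by
    rcases hax.eq_or_lt with rfl | hlt
    · linarith
    have h4 : 0 ≤ g' (σ x) - u' x := by
      refine ge_of_tendsto (hcont.tendsto.mono_left (nhdsWithin_le_nhds (s := Iio x))) ?_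
      filter_upwards [Ico_mem_nhdsLT hlt] with y hy
      linarith [(hx y hy).2]
    refine lt_of_le_of_ne h4 fun h5 => ?_
    have h6 : u' x = g' (σ x) := by linarith
    have hgn := hg.deriv_neg _ h1
    have hup := hpos x hx0
    have h7 := hslope x hlt hux hx
    have hσx : σ x < x := by
      rw [logSlope, logSlope, h2, h6, neg_lt_neg_iff, div_lt_div_iff_of_pos_right hup] at h7
      nlinarith
    refine not_pos_left_of_hasDerivAt_pos (h := fun r => g' (σ r) - u' r) hlt hD ?_ h5.symm.le
      fun y hy => by linarith [(hx y ⟨hy.1.le, hy.2⟩).2]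
    rw [h6, div_self hgn.ne, h2]
    have h8 : d / x < d / σ x := div_lt_div_of_pos_left hd h1 hσx
    nlinarith
  refine ⟨⟨hux, by linarith⟩, ?_⟩
  filter_upwards [((hs.deriv1 x hx0).continuousAt.eventually (gt_mem_nhds hux)).filter_mono
    nhdsWithin_le_nhds, (hcont.eventually (lt_mem_nhds hlt)).filter_mono nhdsWithin_le_nhds]
    with y hy1 hy2 using ⟨hy1, by linarith⟩

/-- A positive solution starting above the ground state ends up with a logarithmic slope exceeding
that of the ground state at equal height by a fixed factor. -/
theorem exists_steeper (hg : Ground d p α₀ g g')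
    (hs : Sol d p u u') (hp : 1 < p) (hd : 1 ≤ d) (hα : α₀ < α)
    (h0 : Tendsto u (nhdsWithin 0 (Ioi 0)) (nhds α))
    (h1 : Tendsto (fun r => u' r / r) (nhdsWithin 0 (Ioi 0)) (nhds (-f p α / (d + 1))))
    (hpos : ∀ r, 0 < r → 0 < u r)
    (hσ : ∀ r, 0 < r → u r < α₀ → 0 < σ r ∧ g (σ r) = u r ∧ HasDerivAt σ (u' r / g' (σ r)) r) :
    ∃ R K, 0 < R ∧ 1 < K ∧ u R = 1 ∧ ∀ r, R ≤ r → u r < α₀ ∧ u' r < g' (σ r) ∧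
      K * logSlope g g' (σ r) < logSlope u u' r := by
  obtain ⟨R, hR, huR, hgt, hph⟩ := exists_logSlope_lt hg hs hp hd hα h0 h1 hpos
  have hα₀ := hg.one_lt
  have huR' : u R < α₀ := by linarith
  obtain ⟨K, hK, hKR⟩ : ∃ K, 1 < K ∧ K * logSlope g g' (σ R) < logSlope u u' R := by
    obtain ⟨h2, h3, -⟩ := hσ R hR huR'
    have h4 := (hph R ⟨hR, le_rfl⟩).2 _ h2 h3
    have h5 := hg.logSlope_pos h2
    obtain ⟨m, hm1, hm2⟩ := exists_between h4
    refine ⟨m / logSlope g g' (σ R), (one_lt_div h5).2 hm1, ?_⟩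
    rwa [div_mul_cancel₀ _ h5.ne']
  obtain ⟨a, ha, haR, hua, hsa⟩ : ∃ a, 0 < a ∧ a < R ∧ u a < α₀ ∧ u' a < g' (σ a) := by
    obtain ⟨b, hb1, hb2⟩ := ((h0.eventually (lt_mem_nhds hα)).and (Ioo_mem_nhdsGT hR)).exists
    obtain ⟨c, hc, huc⟩ := intermediate_value_Ioo' hb2.2.le (hs.continuousOn hb2.1) ⟨huR', hb1⟩
    have hc0 : 0 < c := hb2.1.trans hc.1
    have hu'c := (hph c ⟨hc0, hc.2.le⟩).1
    have hg'0 : Tendsto g' (nhdsWithin 0 (Ioi 0)) (nhds 0) := by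
      have hr0 : Tendsto (fun r : ℝ => r) (nhdsWithin 0 (Ioi 0)) (nhds 0) :=
        tendsto_id.mono_left nhdsWithin_le_nhds
      have h2 := hr0.mul hg.tendsto_deriv_div
      rw [zero_mul] at h2
      refine h2.congr' ?_
      filter_upwards [self_mem_nhdsWithin] with r hr
      exact mul_div_cancel₀ _ (show 0 < r from hr).ne'
    obtain ⟨m, hm1, hm2⟩ := exists_between hu'c
    obtain ⟨δ, hδ, hδ'⟩ := mem_nhdsGT_iff_exists_Ioo_subset.1
      (hg'0.eventually (lt_mem_nhds hm2))
    have hδ0 : 0 < δ := hδ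
    have hgδ : g δ < u c := by rw [huc]; exact hg.lt_init hδ0
    have hleft := (hs.deriv1 c hc0)
    have hev : ∀ᶠ r in nhdsWithin c (Ioi c), u r < α₀ := by
      have h3 := (hasDerivAt_iff_tendsto_slope_left_right.1 hleft).2
      filter_upwards [h3.eventually (gt_mem_nhds hu'c), self_mem_nhdsWithin] with y hy1 hy2
      rw [slope_def_field, div_neg_iff] at hy1
      have : c < y := hy2
      rcases hy1 with h | h <;> linarith [h.1, h.2]
    obtain ⟨a, ⟨⟨h3, h4⟩, h5⟩, h6⟩ := (((hev.and
      ((hleft.continuousAt.eventually (lt_mem_nhds hgδ)).filter_mono nhdsWithin_le_nhds)).and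
      (((hs.deriv2 c hc0).continuousAt.eventually (gt_mem_nhds hm1)).filter_mono
      nhdsWithin_le_nhds)).and (Ioo_mem_nhdsGT hc.2)).exists
    have ha0 : 0 < a := hc0.trans h6.1
    obtain ⟨h7, h8, -⟩ := hσ a ha0 h3
    have h9 : σ a < δ := by
      rw [← h8] at h4
      exact (hg.strictAntiOn.lt_iff_gt hδ0 h7).1 h4
    have h10 : m < g' (σ a) := hδ' ⟨h7, h9⟩
    exact ⟨a, ha0, h6.2, h3, h5.trans h10⟩
  have hslopeK : ∀ x, (∀ r ∈ Ico R x, u r < α₀ ∧ u' r < g' (σ r)) →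
      ∀ r ∈ Ico R x, K * logSlope g g' (σ r) < logSlope u u' r := fun x hx =>
    mul_logSlope_lt_of_steeper hg hs hp hd hpos hσ hR huR hK hx hKR
  have hP := steeper_of_logSlope_lt hg hs (by linarith) hpos hσ ha hua hsa fun x hax hux hx => by
    have hx0 : 0 < x := ha.trans hax
    obtain ⟨h2, h3, h4⟩ := hσ x hx0 hux
    rcases le_or_gt x R with hxR | hxR
    · exact (hph x ⟨hx0, hxR⟩).2 _ h2 h3
    have h5 := hslopeK x fun r hr => hx r ⟨haR.le.trans hr.1, hr.2⟩
    have hc : ContinuousAt (fun r => logSlope u u' r - K * logSlope g g' (σ r)) x :=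
      ((hs.hasDerivAt_logSlope hx0 (hpos x hx0)).sub
        (((hg.hasDerivAt_logSlope h2).comp x h4).const_mul K)).continuousAt
    have h6 : 0 ≤ logSlope u u' x - K * logSlope g g' (σ x) := by
      refine ge_of_tendsto (hc.tendsto.mono_left (nhdsWithin_le_nhds (s := Iio x))) ?_
      filter_upwards [Ico_mem_nhdsLT hxR] with y hy
      linarith [h5 y hy]
    have h7 := lt_mul_of_one_lt_left (hg.logSlope_pos h2) hK
    linarith
  refine ⟨R, K, hR, hK, huR, fun r hr => ?_⟩
  have h2 := hP r (haR.le.trans hr)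
  exact ⟨h2.1, h2.2, hslopeK (r + 1) (fun y hy => hP y (haR.le.trans hy.1)) r
    ⟨hr, by linarith⟩⟩

end HeightMatching

/-- A positive solution decaying strictly faster than `exp (-r)` runs into a Riccati blow-up. -/
theorem Sol.false_of_steep {d p η a : ℝ} {u u' : ℝ → ℝ} (hs : Sol d p u u') (ha : 0 < a)
    (hpos : ∀ r, a ≤ r → 0 < u r) (hu' : ∀ r, a ≤ r → u' r ≤ 0) (hη : 0 < η)
    (hsteep : ∀ r, a ≤ r → (1 + η) * u r ^ 2 ≤ u' r ^ 2) : False := by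
  have hη2 : 0 < 2 + η := by linarith
  obtain ⟨k, hk⟩ : ∃ k, k = η / (2 * (2 + η)) := ⟨_, rfl⟩
  have hk0 : 0 < k := by rw [hk]; positivity
  obtain ⟨b, hb⟩ : ∃ b, b = max a (d / k) := ⟨_, rfl⟩
  have hab : a ≤ b := hb ▸ le_max_left _ _
  refine no_global_riccati (ψ := fun r => -u' r / u r)
    (ψ' := fun r => (-u' r / u r) ^ 2 - d / r * (-u' r / u r) - 1 + u r ^ (p - 1)) (a := b) hk0
    (fun r hr => ?_) fun r hr => ?_
  · have hr0 : 0 < r := by linarith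
    have hur := hpos r (by linarith)
    refine ((hs.deriv2 r hr0).neg.div (hs.deriv1 r hr0) hur.ne').congr_deriv ?_
    rw [f_of_pos hur]
    simp only [Pi.neg_apply]
    field_simp
    ring
  · have hr0 : 0 < r := by linarith
    have har : a ≤ r := hab.trans hr
    have hur := hpos r har
    have hψ : 0 ≤ -u' r / u r := div_nonneg (neg_nonneg.2 (hu' r har)) hur.le
    have hψ2 : 1 + η ≤ (-u' r / u r) ^ 2 := by
      rw [div_pow, neg_sq, le_div_iff₀ (by positivity)]
      exact hsteep r har
    have hy : 0 ≤ u r ^ (p - 1) := rpow_nonneg hur.le _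
    have hdr : d / r ≤ k := by
      rw [div_le_iff₀ hr0, ← div_le_iff₀' hk0]
      exact (hb ▸ le_max_right a (d / k)).trans hr
    generalize -u' r / u r = ψ at *
    have h1 : d / r * ψ ≤ k * (1 + ψ ^ 2) :=
      (mul_le_mul_of_nonneg_right hdr hψ).trans (by nlinarith [sq_nonneg (ψ - 1)])
    have h2 : 2 * k * (1 + ψ ^ 2) ≤ ψ ^ 2 - 1 := by
      have h3 : 2 * k = η / (2 + η) := by rw [hk]; field_simp
      rw [h3, div_mul_eq_mul_div, div_le_iff₀ hη2]
      linarith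
    linarith

/-- Above a ground state, a solution cannot remain positive. -/
theorem Ground.exists_not_pos {d p α₀ α : ℝ} {g g' u u' : ℝ → ℝ} (hg : Ground d p α₀ g g')
    (hs : Sol d p u u') (hp : 1 < p) (hd : 1 ≤ d) (hα : α₀ < α)
    (h0 : Tendsto u (nhdsWithin 0 (Ioi 0)) (nhds α))
    (h1 : Tendsto (fun r => u' r / r) (nhdsWithin 0 (Ioi 0)) (nhds (-f p α / (d + 1)))) :
    ∃ r, 0 < r ∧ u r ≤ 0 := by
  by_contra! hpos
  obtain ⟨σ, hσ⟩ := exists_heightMatching hg hs hpos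
  obtain ⟨R, K, hR, hK, huR, hst⟩ := exists_steeper hg hs hp hd hα h0 h1 hpos hσ
  have hneg : ∀ r, R ≤ r → u' r < 0 := fun r hr =>
    (hst r hr).2.1.trans (hg.deriv_neg _ (hσ r (by linarith) (hst r hr).1).1)
  have hlt : ∀ r, R < r → u r < 1 := fun r hr => by
    have := lt_of_hasDerivAt_pos (h := fun r => -u r) (h' := fun r => -u' r) hr
      (hs.continuousOn hR).neg (fun y hy => (hs.deriv1 y (hR.trans hy.1)).neg) fun y hy =>
        neg_pos.2 (hneg y hy.1.le)
    linarith
  have hu0 : Tendsto u atTop (nhds 0) :=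
    (hs.decaying_of_ne_one hp (by linarith) (R := R + 1) (by linarith)
      (fun r hr => hpos r (by linarith)) fun r hr => (hlt r (by linarith)).ne).1
  have hy0 : Tendsto (fun r => u r ^ (p - 1)) atTop (nhds 0) := by
    have := hu0.rpow_const (p := p - 1) (Or.inr (by linarith))
    rwa [zero_rpow (by linarith)] at this
  have hσr : ∀ r, R ≤ r → r - R + σ R ≤ σ r := fun r hr => by
    have hD : ∀ x, R ≤ x → HasDerivAt (fun x => σ x - x) (u' x / g' (σ x) - 1) x := fun x hx =>
      (hσ x (by linarith) (hst x hx).1).2.2.sub (hasDerivAt_id x)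
    have := le_of_hasDerivAt_nonneg (h := fun x => σ x - x) hr
      (fun x hx => (hD x hx.1).continuousAt.continuousWithinAt) (fun x hx => hD x hx.1.le)
      fun x hx => by
        have h2 := hst x hx.1.le
        have h3 := hg.deriv_neg _ (hσ x (by linarith [hx.1]) h2.1).1
        rw [sub_nonneg, one_le_div_of_neg h3]
        exact h2.2.1.le
    linarith
  obtain ⟨η, hη, hηK⟩ : ∃ η, 0 < η ∧ K = 1 + 2 * η := ⟨(K - 1) / 2, by linarith, by ring⟩
  have hsmall : ∀ᶠ r in atTop, u r ^ (p - 1) < 1 - 1 / (1 + η) := by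
    refine hy0.eventually (gt_mem_nhds ?_)
    rw [sub_pos, div_lt_one (by linarith)]
    linarith
  obtain ⟨b, hb⟩ := eventually_atTop.1 (hsmall.and
    ((eventually_ge_atTop R).and (eventually_ge_atTop (K * R / η))))
  have hRb : R ≤ b := (hb b le_rfl).2.1
  refine hs.false_of_steep (η := η) (a := b) (by linarith)
    (fun r hr => hpos r (by linarith)) (fun r hr => (hneg r (by linarith)).le) hη fun r hr => ?_
  obtain ⟨hy, hRr, hKr⟩ := hb r hr
  have hr0 : 0 < r := by linarith
  obtain ⟨h2, h3, h4⟩ := hst r hRr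
  obtain ⟨h5, h6, -⟩ := hσ r hr0 h2
  have hur := hpos r hr0
  have hgn := hg.deriv_neg _ h5
  have hσR := (hσ R hR (hst R le_rfl).1).1
  have h7 : (1 + η) * r ≤ K * σ r := by
    rw [div_le_iff₀ hη] at hKr
    have h8 := mul_le_mul_of_nonneg_left (hσr r hRr) (show 0 ≤ K by linarith)
    have h9 : 0 < K * σ R := by positivity
    rw [hηK] at *
    nlinarith
  have h8 : (1 + η) * -g' (σ r) ≤ -u' r := by
    rw [logSlope, logSlope, h6, ← neg_div, ← neg_div, ← mul_div_assoc,
      div_lt_div_iff_of_pos_right hur] at h4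
    have h9 := mul_le_mul_of_nonneg_right h7 (neg_pos.2 hgn).le
    refine le_of_mul_le_mul_left ?_ hr0
    linarith
  have h9 : (1 + η) ^ 2 * g' (σ r) ^ 2 ≤ u' r ^ 2 := by
    have := pow_le_pow_left₀ (mul_nonneg (by linarith) (neg_pos.2 hgn).le) h8 2
    rw [mul_pow, neg_sq, neg_sq] at this
    exact this
  have h10 := hg.energy_nonneg _ h5
  rw [h6, F_eq hp, abs_of_pos hur] at h10
  have hy1 : 0 ≤ u r ^ (p - 1) := rpow_nonneg hur.le _
  generalize u r ^ (p - 1) = y at *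
  have h11 : y / (p + 1) ≤ y / 2 := div_le_div_of_nonneg_left hy1 two_pos (by linarith)
  have h12 : 1 ≤ (1 + η) * (1 - y) := by
    have h13 : 1 / (1 + η) ≤ 1 - y := by linarith
    rwa [div_le_iff₀' (by linarith)] at h13
  have h14 : u r ^ 2 * (1 - y) ≤ g' (σ r) ^ 2 := by
    have := mul_le_mul_of_nonneg_left h11 (sq_nonneg (u r))
    linarith
  calc (1 + η) * u r ^ 2 ≤ (1 + η) * u r ^ 2 * ((1 + η) * (1 - y)) :=
        le_mul_of_one_le_right (by positivity) h12
    _ = (1 + η) ^ 2 * (u r ^ 2 * (1 - y)) := by ring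
    _ ≤ (1 + η) ^ 2 * g' (σ r) ^ 2 := by gcongr
    _ ≤ u' r ^ 2 := h9

/-- A solution starting above a ground state has a zero. -/
theorem IsSolution.exists_zero {n : ℕ} {p α₀ α : ℝ} {g g' u u' u'' : ℝ → ℝ}
    (h : IsSolution n p α u u' u'') (hg : Ground ((n : ℝ) - 1) p α₀ g g') (hp : 1 < p)
    (hn : 2 ≤ n) (hα : α₀ < α) : ∃ z, 0 < z ∧ u z = 0 := by
  have h1 := h.tendsto_deriv_div hp (by omega)
  rw [← sub_add_cancel (n : ℝ) 1] at h1
  have hn' : (2 : ℝ) ≤ n := by exact_mod_cast hn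
  obtain ⟨r, hr, hur⟩ := hg.exists_not_pos h.sol hp (by linarith) hα h.tendsto_zero h1
  obtain ⟨b, hb1, hb2⟩ := ((h.tendsto_zero.eventually
    (lt_mem_nhds (show 0 < α by linarith [hg.one_lt]))).and (Ioo_mem_nhdsGT hr)).exists
  obtain ⟨z, hz, huz⟩ := intermediate_value_Icc' hb2.2.le (h.sol.continuousOn hb2.1) ⟨hur, hb1.le⟩
  exact ⟨z, hb2.1.trans_le hz.1, huz⟩

/-- above the ground-state initial value, every solution is a nodal solution
with finitely many (and at least one) zeros, and is either a decaying bound state or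
oscillates about `1` or `-1` behind its last zero. -/
theorem statement12 (n : ℕ) (hn : 3 ≤ n) (p : ℝ) (hp1 : 1 < p)
    (hp2 : p < ((n : ℝ) + 2) / ((n : ℝ) - 2))
    (α₀ : ℝ) (hα₀ : 0 < α₀) (u₀ u₀' u₀'' : ℝ → ℝ)
    (h₀ : IsSolution n p α₀ u₀ u₀' u₀'')
    (hground : Decaying u₀ u₀' ∧ ∀ r : ℝ, 0 ≤ r → 0 < u₀ r)
    (α : ℝ) (hα : α₀ < α)
    (u u' u'' : ℝ → ℝ) (hu : IsSolution n p α u u' u'') :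
    ChangesSign u ∧
    ∃ (k : ℕ) (hk : 0 < k) (z : Fin k → ℝ), ExactZeros u k z ∧
      (Decaying u u' ∨
        {r : ℝ | z ⟨k - 1, by omega⟩ < r ∧ u r = 1}.Infinite ∨
        {r : ℝ | z ⟨k - 1, by omega⟩ < r ∧ u r = -1}.Infinite) := by
  have hα' : 0 < α := hα₀.trans hα
  have hg := h₀.ground hp1 hn hp2 hground.1 hground.2
  obtain ⟨ζ, hζ, huζ⟩ := hu.exists_zero hg hp1 (by omega) hα
  obtain ⟨m, z, hz, h⟩ := hu.exists_exactZeros hp1 hn hα' hζ huζ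
  exact ⟨hu.changesSign hp1 (by omega) hα' hζ huζ, m + 1, m.succ_pos, z, hz, h⟩
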